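/- arXiv:1809.00497 — 3 statements merged into one kernel-verified Lean document; each statement's English description precedes it below -/
import Mathlib

section
/- For the filiform Lie superalgebra F_{2,2}^3 over an algebraically closed field of characteristic zero, the Betti numbers of cohomology with trivial coefficients are dim H^0 = 1, dim H^1 = 3, and dim H^k = 4 for all k ≥ 2. -/
open scoped Classical
open Finset

noncomputable section

namespace SuperCE

variable (F : Type*) [Field F] {B : Type*} [Fintype B] [DecidableEq B]

/-- Cochains of the super Chevalley–Eilenberg complex with trivial coefficients:
finitely supported families of coefficients indexed by exponent vectors of monomials in
the dual generators (exterior in duals of even basis vectors, polynomial in duals of odd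
basis vectors). -/
abbrev Cochain (F : Type*) [Field F] (B : Type*) := (B → ℕ) →₀ F

variable (p ord : B → ℕ) (c : B → B → B → F)

/-- exponent vector of a single dual generator -/
def eps (b : B) : B → ℕ := fun x => if x = b then 1 else 0

/-- cohomological (`ℤ`-) degree of a monomial -/
def deg (μ : B → ℕ) : ℕ := ∑ b, μ b

/-- admissible exponent vectors: duals of even basis vectors are exterior generators -/
def IsAdm (μ : B → ℕ) : Prop := ∀ b, p b = 0 → μ b ≤ 1

/-- Koszul sign for multiplying the ordered monomial with exponent vector `μ` by the one
with exponent vector `ν`: two dual generators supercommute, i.e. anticommute except that a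
pair of generators dual to odd basis vectors commutes. -/
def sgnProd (μ ν : B → ℕ) : F :=
  (-1 : F) ^ (∑ b1, ∑ b2, if ord b2 < ord b1 then μ b1 * ν b2 * (1 + p b1 * p b2) else 0)

/-- the supercommutative product of cochains (wedge/polynomial multiplication) -/
def Pmul (f g : Cochain F B) : Cochain F B :=
  f.sum fun μ a => g.sum fun ν b' =>
    if IsAdm p (fun x => μ x + ν x) then
      Finsupp.single (fun x => μ x + ν x) (a * b' * sgnProd F p ord μ ν)
    else 0

/-- coefficients of the differential on a dual generator `x_b*`, namely
`d(x_b*) = ∑_{k<l} (-1)^{|x_k||x_l|} c k l b x_k* x_l* - (1/2) ∑_{k odd} c k k b x_k*²`,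
where `c k l b` is the structure constant of the Lie superalgebra. -/
def dcoef (b k l : B) : F :=
  if ord k < ord l then (-1 : F) ^ (p k * p l) * c k l b
  else if k = l ∧ p k = 1 then -((2 : F)⁻¹) * c k k b
  else 0

/-- target exponent vector obtained from `μ` by differentiating the generator `b`
into the pair `(k, l)` -/
def tgt (μ : B → ℕ) (b k l : B) : B → ℕ :=
  fun x => μ x - eps b x + eps k x + eps l x

/-- the Chevalley–Eilenberg differential of a single monomial, obtained by extending `d`
on generators as a `ℤ`-degree `+1`, parity-even superderivation (Koszul signs included) -/
def dMono (μ : B → ℕ) : Cochain F B :=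
  ∑ b, ∑ k, ∑ l,
    if μ b ≠ 0 ∧ IsAdm p (tgt μ b k l) then
      Finsupp.single (tgt μ b k l)
        (((-1 : F) ^ (∑ b', if ord b' < ord b then μ b' else 0)) *
         (μ b : F) * ((-1 : F) ^ ((μ b - 1) * p b)) *
         ((-1 : F) ^ (p b * ∑ b'', if ord b < ord b'' then μ b'' * p b'' else 0)) *
         dcoef F p ord c b k l *
         sgnProd F p ord (fun x => μ x - eps b x) (fun x => eps k x + eps l x))
    else 0

/-- the Chevalley–Eilenberg differential with trivial coefficients -/
def d : Cochain F B →ₗ[F] Cochain F B :=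
  Finsupp.lsum F fun μ => LinearMap.toSpanSingleton F (Cochain F B) (dMono F p ord c μ)

/-- cochains supported on admissible monomials of cohomological degree `k`,
i.e. the `k`-th term `Λᵏ g*` of the super Chevalley–Eilenberg complex -/
def AdmDeg (k : ℕ) : Submodule F (Cochain F B) where
  carrier := {f | ∀ μ, f μ ≠ 0 → IsAdm p μ ∧ deg μ = k}
  add_mem' := by
    intro f g hf hg μ hμ
    by_cases h1 : f μ = 0
    · exact hg μ (by simpa [Finsupp.add_apply, h1] using hμ)
    · exact hf μ h1
  zero_mem' := by intro μ hμ; simp at hμ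
  smul_mem' := by
    intro a f hf μ hμ
    exact hf μ (fun h0 => hμ (by simp [Finsupp.smul_apply, h0]))

/-- cochains supported on admissible monomials (of any degree), i.e. `Λ• g*` -/
def AdmAll : Submodule F (Cochain F B) where
  carrier := {f | ∀ μ, f μ ≠ 0 → IsAdm p μ}
  add_mem' := by
    intro f g hf hg μ hμ
    by_cases h1 : f μ = 0
    · exact hg μ (by simpa [Finsupp.add_apply, h1] using hμ)
    · exact hf μ h1
  zero_mem' := by intro μ hμ; simp at hμ
  smul_mem' := by
    intro a f hf μ hμ
    exact hf μ (fun h0 => hμ (by simp [Finsupp.smul_apply, h0]))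

/-- degree-`k` cocycles -/
def Zk (k : ℕ) : Submodule F (Cochain F B) :=
  AdmDeg F p k ⊓ LinearMap.ker (d F p ord c)

/-- degree-`k` coboundaries -/
def Bk (k : ℕ) : Submodule F (Cochain F B) :=
  Submodule.map (d F p ord c) (AdmDeg F p (k - 1))

/-- the dimension (Betti number) of the `k`-th Lie superalgebra cohomology
`H^k = Z^k / B^k` with trivial coefficients -/
def Hdim (k : ℕ) : ℕ :=
  Module.finrank F ↥(Zk F p ord c k) -
    Module.finrank F ↥(Bk F p ord c k ⊓ Zk F p ord c k)

end SuperCE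

end

noncomputable section
namespace Paper
open SuperCE

/-- parity of the basis (evens then odds) -/
def pF223 : Fin 3 ⊕ Fin 2 → ℕ := Sum.elim (fun _ => 0) (fun _ => 1)

/-- ordering of the basis -/
def ordF223 : Fin 3 ⊕ Fin 2 → ℕ :=
  Sum.elim (fun i => (i : ℕ)) (fun j => 3 + (j : ℕ))

/-- structure constants -/
def cF223 (F : Type*) [Field F] :
    (Fin 3 ⊕ Fin 2) → (Fin 3 ⊕ Fin 2) → (Fin 3 ⊕ Fin 2) → F :=
  fun a b t =>
    if a = Sum.inl (0 : Fin 3) ∧ b = Sum.inl (1 : Fin 3) ∧ t = Sum.inl (2 : Fin 3) then 1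
    else if a = Sum.inl (1 : Fin 3) ∧ b = Sum.inl (0 : Fin 3) ∧ t = Sum.inl (2 : Fin 3) then -1
    else    if a = Sum.inr (0 : Fin 2) ∧ b = Sum.inr (0 : Fin 2) ∧ t = Sum.inl (2 : Fin 3) then 1
    else    if a = Sum.inl (0 : Fin 3) ∧ b = Sum.inr (0 : Fin 2) ∧ t = Sum.inr (1 : Fin 2) then 1
    else if a = Sum.inr (0 : Fin 2) ∧ b = Sum.inl (0 : Fin 3) ∧ t = Sum.inr (1 : Fin 2) then -1
    else 0

end Paper
end

noncomputable section
namespace SuperCE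

/-- Linear maps agreeing on admissible monomials agree on admissible cochains. -/
lemma linearMap_eq_of_isAdm {F : Type*} [Field F] {B : Type*} {p : B → ℕ} {M : Type*} [AddCommGroup M] [Module F M]
    {L₁ L₂ : Cochain F B →ₗ[F] M}
    (h : ∀ μ, IsAdm p μ → L₁ (Finsupp.single μ 1) = L₂ (Finsupp.single μ 1))
    {f : Cochain F B} (hf : ∀ μ, f μ ≠ 0 → IsAdm p μ) : L₁ f = L₂ f := by
  rw [← Finsupp.sum_single f, Finsupp.sum, map_sum, map_sum]
  refine Finset.sum_congr rfl fun μ hμ => ?_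
  have := h μ (hf μ (Finsupp.mem_support_iff.1 hμ))
  rw [← mul_one (f μ), ← smul_eq_mul, ← Finsupp.smul_single, map_smul, map_smul, this]

section General

variable {F : Type*} [Field F] {B : Type*} [Fintype B] [DecidableEq B]
  {p ord : B → ℕ} {c : B → B → B → F}

lemma d_single (μ : B → ℕ) (a : F) :
    d F p ord c (Finsupp.single μ a) = a • dMono F p ord c μ := by
  simp [d]

lemma dMono_apply_of_not_isAdm (μ : B → ℕ) {ν : B → ℕ} (hν : ¬ IsAdm p ν) :
    dMono F p ord c μ ν = 0 := by
  simp only [dMono, Finsupp.finsetSum_apply]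
  refine Finset.sum_eq_zero fun b _ => Finset.sum_eq_zero fun k _ =>
    Finset.sum_eq_zero fun l _ => ?_
  split_ifs with h
  · exact Finsupp.single_eq_of_ne fun hh => hν (hh ▸ h.2)
  · rfl

lemma d_apply_of_not_isAdm (f : Cochain F B) {ν : B → ℕ} (hν : ¬ IsAdm p ν) :
    d F p ord c f ν = 0 := by
  induction f using Finsupp.induction_linear with
  | zero => simp
  | add f g hf hg => simp [hf, hg]
  | single μ a => simp [d_single, dMono_apply_of_not_isAdm μ hν]

lemma finiteDimensional_admDeg (k : ℕ) : FiniteDimensional F (AdmDeg F p k) := by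
  have hle : AdmDeg F p k ≤
      Finsupp.supported F F (Finset.piAntidiag (univ : Finset B) k : Set (B → ℕ)) := by
    intro f hf μ hμ
    have := (hf μ (by simpa using hμ)).2
    simpa [deg] using this
  have : FiniteDimensional F
      (Finsupp.supported F F (Finset.piAntidiag (univ : Finset B) k : Set (B → ℕ))) :=
    Module.Finite.equiv (Finsupp.supportedEquivFinsupp _).symm
  exact Submodule.finiteDimensional_of_le hle

lemma exists_mem_admDeg {k : ℕ} (γ : (B → ℕ) → F)
    (hγ : ∀ μ, γ μ ≠ 0 → IsAdm p μ ∧ deg μ = k) : ∃ g ∈ AdmDeg F p k, ⇑g = γ := by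
  refine ⟨Finsupp.onFinset (Finset.piAntidiag univ k) γ fun μ hμ => ?_, fun μ hμ => hγ μ hμ, rfl⟩
  simpa [deg] using (hγ μ hμ).2

/-- The Betti number is computed by any linear map which is onto from the cocycles and whose
kernel on the cocycles consists of the coboundaries. -/
lemma hdim_eq {k n : ℕ} (φ : Cochain F B →ₗ[F] (Fin n → F))
    (hker : ∀ z ∈ Zk F p ord c k, φ z = 0 ↔ z ∈ Bk F p ord c k)
    (hsurj : ∀ w, ∃ z ∈ Zk F p ord c k, φ z = w) : Hdim F p ord c k = n := by
  have := finiteDimensional_admDeg (F := F) (p := p) k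
  have : FiniteDimensional F (Zk F p ord c k) :=
    Submodule.finiteDimensional_of_le (inf_le_left : Zk F p ord c k ≤ AdmDeg F p k)
  have hrange : LinearMap.range (φ.domRestrict (Zk F p ord c k)) = ⊤ := by
    rw [LinearMap.range_eq_top]
    intro w
    obtain ⟨z, hz, rfl⟩ := hsurj w
    exact ⟨⟨z, hz⟩, rfl⟩
  have hmap : (LinearMap.ker (φ.domRestrict (Zk F p ord c k))).map (Zk F p ord c k).subtype =
      Bk F p ord c k ⊓ Zk F p ord c k := by
    ext z
    simp only [Submodule.mem_map, LinearMap.mem_ker, Submodule.mem_inf]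
    constructor
    · rintro ⟨⟨y, hy⟩, h, rfl⟩
      exact ⟨(hker y hy).1 h, hy⟩
    · rintro ⟨hb, hz⟩
      exact ⟨⟨z, hz⟩, (hker z hz).2 hb, rfl⟩
  have h1 := LinearMap.finrank_range_add_finrank_ker (K := F) (V := Zk F p ord c k) (V₂ := Fin n → F)
    (φ.domRestrict (Zk F p ord c k))
  rw [hrange, finrank_top, Module.finrank_fin_fun] at h1
  rw [Hdim, ← hmap, Submodule.finrank_map_subtype_eq]
  omega

end General

end SuperCE

namespace Paper
open SuperCE

/-- The exponent vector of the monomial `X₀*ⁱ X₁*ʲ X₂*ᵉ Y₁*ᵖ Y₂*^q`. -/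
def mono (i j e p q : ℕ) : Fin 3 ⊕ Fin 2 → ℕ := Sum.elim ![i, j, e] ![p, q]

lemma mono_eta (μ : Fin 3 ⊕ Fin 2 → ℕ) :
    mono (μ (.inl 0)) (μ (.inl 1)) (μ (.inl 2)) (μ (.inr 0)) (μ (.inr 1)) = μ := by
  ext x
  rcases x with x | x <;> fin_cases x <;> rfl

@[simp]
lemma mono_inj {i j e p q i' j' e' p' q' : ℕ} :
    mono i j e p q = mono i' j' e' p' q' ↔ i = i' ∧ j = j' ∧ e = e' ∧ p = p' ∧ q = q' := by
  refine ⟨fun h => ?_, by rintro ⟨rfl, rfl, rfl, rfl, rfl⟩; rfl⟩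
  exact ⟨congrFun h (.inl 0), congrFun h (.inl 1), congrFun h (.inl 2), congrFun h (.inr 0),
    congrFun h (.inr 1)⟩

@[simp]
lemma deg_mono (i j e p q : ℕ) : deg (mono i j e p q) = i + j + e + p + q := by
  simp [deg, mono, Fin.sum_univ_succ]
  ring

@[simp]
lemma isAdm_mono {i j e p q : ℕ} : IsAdm pF223 (mono i j e p q) ↔ i ≤ 1 ∧ j ≤ 1 ∧ e ≤ 1 := by
  simp [IsAdm, mono, pF223, Fin.forall_fin_succ]

variable {F : Type*} [Field F]

lemma tgt_mono_X₂_X₀_X₁ (i j e p q : ℕ) :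
    tgt (mono i j e p q) (.inl 2) (.inl 0) (.inl 1) = mono (i + 1) (j + 1) (e - 1) p q := by
  ext x
  rcases x with x | x <;> fin_cases x <;> simp [tgt, mono, eps]

lemma tgt_mono_X₂_Y₁_Y₁ (i j e p q : ℕ) :
    tgt (mono i j e p q) (.inl 2) (.inr 0) (.inr 0) = mono i j (e - 1) (p + 2) q := by
  ext x
  rcases x with x | x <;> fin_cases x <;> simp [tgt, mono, eps]

lemma tgt_mono_Y₂_X₀_Y₁ (i j e p q : ℕ) :
    tgt (mono i j e p q) (.inr 1) (.inl 0) (.inr 0) = mono (i + 1) j e (p + 1) (q - 1) := by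
  ext x
  rcases x with x | x <;> fin_cases x <;> simp [tgt, mono, eps]

lemma dcoef_F223 (b k l : Fin 3 ⊕ Fin 2) :
    dcoef F pF223 ordF223 (cF223 F) b k l =
      if b = .inl 2 ∧ k = .inl 0 ∧ l = .inl 1 then 1
      else if b = .inl 2 ∧ k = .inr 0 ∧ l = .inr 0 then -2⁻¹
      else if b = .inr 1 ∧ k = .inl 0 ∧ l = .inr 0 then 1
      else 0 := by
  rcases b with b | b <;> fin_cases b <;> rcases k with k | k <;> fin_cases k <;>
    rcases l with l | l <;> fin_cases l <;> simp [dcoef, pF223, ordF223, cF223]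

lemma sum_dcoef_F223 (F : Type*) [Field F] {M : Type*} [AddCommMonoid M]
    (t : Fin 3 ⊕ Fin 2 → Fin 3 ⊕ Fin 2 → Fin 3 ⊕ Fin 2 → M)
    (ht : ∀ b k l, dcoef F pF223 ordF223 (cF223 F) b k l = 0 → t b k l = 0) :
    ∑ b, ∑ k, ∑ l, t b k l =
      t (.inl 2) (.inl 0) (.inl 1) + t (.inl 2) (.inr 0) (.inr 0) +
        t (.inr 1) (.inl 0) (.inr 0) := by
  have h (b k l) (h1 : ¬ (b = .inl 2 ∧ k = .inl 0 ∧ l = .inl 1))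
      (h2 : ¬ (b = .inl 2 ∧ k = .inr 0 ∧ l = .inr 0))
      (h3 : ¬ (b = .inr 1 ∧ k = .inl 0 ∧ l = .inr 0)) : t b k l = 0 :=
    ht b k l (by simp only [dcoef_F223, if_neg h1, if_neg h2, if_neg h3])
  rw [Fintype.sum_eq_add (.inl 2) (.inr 1) (by simp) (fun b hb => ?_),
    Fintype.sum_eq_add (.inl 0) (.inr 0) (by simp) (fun k hk => ?_),
    Fintype.sum_eq_single (.inl 1) (fun l hl => ?_),
    Fintype.sum_eq_single (.inr 0) (fun l hl => ?_),
    Fintype.sum_eq_single (.inl 0) (fun k hk => ?_),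
    Fintype.sum_eq_single (.inr 0) (fun l hl => ?_)]
  · exact h _ _ _ (by simp) (by simp) (by simp [hl])
  · exact Finset.sum_eq_zero fun l _ => h _ _ _ (by simp) (by simp) (by simp [hk])
  · exact h _ _ _ (by simp) (by simp [hl]) (by simp)
  · exact h _ _ _ (by simp [hl]) (by simp) (by simp)
  · exact Finset.sum_eq_zero fun l _ => h _ _ _ (by simp [hk]) (by simp [hk]) (by simp)
  · exact Finset.sum_eq_zero fun k _ => Finset.sum_eq_zero fun l _ =>
      h _ _ _ (by simp [hb]) (by simp [hb]) (by simp [hb])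

lemma dMono_mono {i j e p q : ℕ} (hi : i ≤ 1) (hj : j ≤ 1) (he : e ≤ 1) :
    dMono F pF223 ordF223 (cF223 F) (mono i j e p q) =
      (if i = 0 ∧ j = 0 ∧ e = 1 then Finsupp.single (mono 1 1 0 p q) 1 else 0) +
      (if e = 1 then Finsupp.single (mono i j 0 (p + 2) q) (-(-1) ^ (i + j) * 2⁻¹) else 0) +
      (if i = 0 then Finsupp.single (mono 1 j e (p + 1) (q - 1)) (q : F) else 0) := by
  rw [dMono, sum_dcoef_F223 F _ (fun b k l h => by simp [h]), tgt_mono_X₂_X₀_X₁,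
    tgt_mono_X₂_Y₁_Y₁, tgt_mono_Y₂_X₀_Y₁]
  have h₁ : dcoef F pF223 ordF223 (cF223 F) (.inl 2) (.inl 0) (.inl 1) = 1 := by
    simp [dcoef_F223]
  have h₂ : dcoef F pF223 ordF223 (cF223 F) (.inl 2) (.inr 0) (.inr 0) = -2⁻¹ := by
    simp [dcoef_F223]
  have h₃ : dcoef F pF223 ordF223 (cF223 F) (.inr 1) (.inl 0) (.inr 0) = 1 := by
    simp [dcoef_F223]
  simp only [isAdm_mono, h₁, h₂, h₃]
  congr 1
  · congr 1
    · interval_cases i <;> interval_cases j <;> interval_cases e <;>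
      rcases neg_one_pow_eq_or F p with hp | hp <;>
      rcases neg_one_pow_eq_or F q with hq | hq <;>
        simp [mono, sgnProd, eps, pF223, ordF223, Fin.sum_univ_succ, pow_add, hp, hq,
          -Finsupp.single_mul, -Finsupp.single_add, -Finsupp.single_neg]
    · interval_cases i <;> interval_cases j <;> interval_cases e <;>
        simp [mono, sgnProd, eps, pF223, ordF223, Fin.sum_univ_succ,
          -Finsupp.single_mul, -Finsupp.single_add, -Finsupp.single_neg]
  · rcases q with _ | q
    · simp [mono]
    · interval_cases i <;> interval_cases j <;> interval_cases e <;>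
      rcases neg_one_pow_eq_or F p with hp | hp <;>
      rcases neg_one_pow_eq_or F q with hq | hq <;>
        simp [mono, sgnProd, eps, pF223, ordF223, Fin.sum_univ_succ, pow_add, pow_mul, hp, hq,
          -Finsupp.single_mul, -Finsupp.single_add, -Finsupp.single_neg]

lemma d_apply_mono {f : Cochain F (Fin 3 ⊕ Fin 2)} (hf : ∀ μ, f μ ≠ 0 → IsAdm pF223 μ)
    {e : ℕ} (he : e ≤ 1) (i j p q : ℕ) :
    d F pF223 ordF223 (cF223 F) f (mono i j e p q) =
      (if i = 1 ∧ j = 1 ∧ e = 0 then f (mono 0 0 1 p q) else 0) +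
      (if e = 0 ∧ 2 ≤ p then -(-1) ^ (i + j) * 2⁻¹ * f (mono i j 1 (p - 2) q) else 0) +
      (if i = 1 ∧ 1 ≤ p then (q + 1) * f (mono 0 j e (p - 1) (q + 1)) else 0) := by
  let L (ν : Fin 3 ⊕ Fin 2 → ℕ) : Cochain F (Fin 3 ⊕ Fin 2) →ₗ[F] F := Finsupp.lapply ν
  have key := linearMap_eq_of_isAdm (p := pF223)
    (L₁ := L (mono i j e p q) ∘ₗ d F pF223 ordF223 (cF223 F))
    (L₂ := (if i = 1 ∧ j = 1 ∧ e = 0 then L (mono 0 0 1 p q) else 0) +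
      (if e = 0 ∧ 2 ≤ p then (-(-1) ^ (i + j) * 2⁻¹ : F) • L (mono i j 1 (p - 2) q) else 0) +
      (if i = 1 ∧ 1 ≤ p then (q + 1 : F) • L (mono 0 j e (p - 1) (q + 1)) else 0))
    (fun μ hμ => ?_) hf
  · refine Eq.trans key ?_
    simp only [LinearMap.add_apply]
    congr 1
    · congr 1 <;> split_ifs <;> simp [L]
    · split_ifs <;> simp [L]
  · rw [← mono_eta μ] at hμ ⊢
    generalize μ (.inl 0) = i', μ (.inl 1) = j', μ (.inl 2) = e', μ (.inr 0) = p',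
      μ (.inr 1) = q' at hμ ⊢
    obtain ⟨hi', hj', he'⟩ := isAdm_mono.1 hμ
    simp only [LinearMap.comp_apply, d_single, one_smul, dMono_mono hi' hj' he', map_add,
      LinearMap.add_apply]
    congr 1
    · congr 1
      · split_ifs <;> simp [L, Finsupp.single_apply] <;> grind
      · split_ifs <;> simp [L, Finsupp.single_apply] <;> grind
    · rcases q' with _ | q' <;> split_ifs <;> simp [L, Finsupp.single_apply] <;> grind

lemma exists_mem_admDeg_mono {k : ℕ} (Γ : ℕ → ℕ → ℕ → ℕ → ℕ → F)
    (hΓ : ∀ i j e p q, Γ i j e p q ≠ 0 → (i ≤ 1 ∧ j ≤ 1 ∧ e ≤ 1) ∧ i + j + e + p + q = k) :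
    ∃ g ∈ AdmDeg F pF223 k, ∀ i j e p q, g (mono i j e p q) = Γ i j e p q := by
  obtain ⟨g, hg, h⟩ := exists_mem_admDeg (p := pF223) (k := k)
    (fun μ => Γ (μ (.inl 0)) (μ (.inl 1)) (μ (.inl 2)) (μ (.inr 0)) (μ (.inr 1)))
    (fun μ hμ => by
      rw [← mono_eta μ, isAdm_mono, deg_mono]
      exact hΓ _ _ _ _ _ hμ)
  exact ⟨g, hg, fun i j e p q => congrFun h _⟩

lemma cochain_ext {f g : Cochain F (Fin 3 ⊕ Fin 2)} (hf : ∀ μ, f μ ≠ 0 → IsAdm pF223 μ)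
    (hg : ∀ μ, g μ ≠ 0 → IsAdm pF223 μ)
    (h : ∀ i ≤ 1, ∀ j ≤ 1, ∀ e ≤ 1, ∀ p q, f (mono i j e p q) = g (mono i j e p q)) : f = g := by
  ext μ
  by_cases hμ : IsAdm pF223 μ
  · rw [← mono_eta μ] at hμ ⊢
    obtain ⟨hi, hj, he⟩ := isAdm_mono.1 hμ
    exact h _ hi _ hj _ he _ _
  · rw [not_not.1 (mt (hf μ) hμ), not_not.1 (mt (hg μ) hμ)]

lemma isAdm_of_d_apply_ne_zero (f : Cochain F (Fin 3 ⊕ Fin 2)) (μ : Fin 3 ⊕ Fin 2 → ℕ)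
    (h : d F pF223 ordF223 (cF223 F) f μ ≠ 0) : IsAdm pF223 μ :=
  by_contra fun hμ => h (d_apply_of_not_isAdm f hμ)

lemma d_eq_zero_iff [CharZero F] {f : Cochain F (Fin 3 ⊕ Fin 2)}
    (hf : ∀ μ, f μ ≠ 0 → IsAdm pF223 μ) :
    d F pF223 ordF223 (cF223 F) f = 0 ↔ ∀ p q,
      f (mono 0 0 1 p q) = 0 ∧ f (mono 0 1 1 p q) = 0 ∧
      f (mono 1 0 1 p q) = -2 * (q + 1) * f (mono 0 0 0 (p + 1) (q + 1)) ∧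
      f (mono 1 1 1 p q) = 2 * (q + 1) * f (mono 0 1 0 (p + 1) (q + 1)) ∧
      f (mono 0 0 0 0 (q + 1)) = 0 ∧ f (mono 0 1 0 0 (q + 1)) = 0 := by
  constructor
  · intro h p q
    have H (i j e p q : ℕ) (he : e ≤ 1) :=
      (d_apply_mono hf he i j p q).symm.trans (by rw [h, Finsupp.zero_apply])
    have hq : (q : F) + 1 ≠ 0 := Nat.cast_add_one_ne_zero q
    have h1 : ∀ p q, f (mono 0 0 1 p q) = 0 := fun p q => by
      simpa using H 0 0 0 (p + 2) q (by simp)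
    have h2 := H 0 1 0 (p + 2) q (by simp)
    have h3 := H 1 0 0 (p + 2) q (by simp)
    have h4 := H 1 1 0 (p + 2) q (by simp)
    have h5 := H 1 0 0 1 q (by simp)
    have h6 := H 1 1 0 1 q (by simp)
    simp [hq, h1] at h2 h3 h4 h5 h6
    refine ⟨h1 p q, h2, ?_, ?_, h5, h6⟩
    · linear_combination 2 * h3
    · linear_combination -2 * h4
  · intro h
    refine cochain_ext (isAdm_of_d_apply_ne_zero f) (by simp) fun i hi j hj e he p q => ?_
    rw [d_apply_mono hf he]
    have h0 (q : ℕ) := (h 0 q).2.2.2.2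
    interval_cases i <;> interval_cases j <;> interval_cases e <;>
      rcases p with _ | _ | p <;> simp [h, h0] <;> ring

lemma mem_Bk_iff [CharZero F] {k : ℕ} {z : Cochain F (Fin 3 ⊕ Fin 2)}
    (hz : z ∈ Zk F pF223 ordF223 (cF223 F) k) :
    z ∈ Bk F pF223 ordF223 (cF223 F) k ↔ ∀ q,
      z (mono 0 0 0 0 q) = 0 ∧ z (mono 0 0 0 1 q) = 0 ∧
      z (mono 0 1 0 0 q) = 0 ∧ z (mono 0 1 0 1 q) = 0 ∧
      z (mono 1 0 0 0 q) = 0 ∧ z (mono 1 1 0 0 q) + 2 * z (mono 0 0 0 2 q) = 0 := by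
  obtain ⟨hzk, hdz⟩ := hz
  have hadm : ∀ μ, z μ ≠ 0 → IsAdm pF223 μ := fun μ hμ => (hzk μ hμ).1
  rw [SetLike.mem_coe, LinearMap.mem_ker, d_eq_zero_iff hadm] at hdz
  constructor
  · rintro ⟨g, hg, rfl⟩ q
    have hg' : ∀ μ, g μ ≠ 0 → IsAdm pF223 μ := fun μ hμ => (hg μ hμ).1
    simp [d_apply_mono hg']
  · intro h
    have hne {i j e p q : ℕ} (hz : z (mono i j e p q) ≠ 0) : i + j + e + p + q = k := by
      simpa using (hzk _ hz).2
    obtain ⟨g, hg, hgΓ⟩ := exists_mem_admDeg_mono (F := F) (k := k - 1)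
      (fun i j e p q => match i, j, e, q with
        | 0, 0, 1, q => -2 * z (mono 0 0 0 (p + 2) q)
        | 0, 1, 1, q => 2 * z (mono 0 1 0 (p + 2) q)
        | 0, 0, 0, q + 1 => z (mono 1 0 0 (p + 1) q) / (q + 1)
        | 0, 1, 0, q + 1 =>
          (z (mono 1 1 0 (p + 1) q) + 2 * z (mono 0 0 0 (p + 3) q)) / (q + 1)
        | _, _, _, _ => 0) (fun i j e p q hΓ => by
          split at hΓ
          · have := hne (right_ne_zero_of_mul hΓ); omega
          · have := hne (right_ne_zero_of_mul hΓ); omega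
          · have := hne (div_ne_zero_iff.1 hΓ).1; omega
          · rename_i q
            by_cases h1 : z (mono 1 1 0 (p + 1) q) = 0
            · by_cases h2 : z (mono 0 0 0 (p + 3) q) = 0
              · simp [h1, h2] at hΓ
              · have := hne h2; omega
            · have := hne h1; omega
          · exact absurd rfl hΓ)
    refine ⟨g, hg, cochain_ext (isAdm_of_d_apply_ne_zero g) hadm fun i hi j hj e he p q => ?_⟩
    rw [d_apply_mono (fun μ hμ => (hg μ hμ).1) he]
    have hq : (q : F) + 1 ≠ 0 := Nat.cast_add_one_ne_zero q
    have := h q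
    interval_cases i <;> interval_cases j <;> interval_cases e <;>
      rcases p with _ | _ | p <;> simp [hgΓ, hdz] <;> grind

lemma apply_mono_eq_zero {k : ℕ} {z : Cochain F (Fin 3 ⊕ Fin 2)}
    (hz : z ∈ AdmDeg F pF223 k) {i j e p q : ℕ} (h : i + j + e + p + q ≠ k) :
    z (mono i j e p q) = 0 :=
  by_contra fun hne => h (by simpa using (hz _ hne).2)

lemma exists_mem_Zk [CharZero F] {k : ℕ} (Γ : ℕ → ℕ → ℕ → ℕ → ℕ → F)
    (hΓ : ∀ i j e p q, Γ i j e p q ≠ 0 → (i ≤ 1 ∧ j ≤ 1 ∧ e ≤ 1) ∧ i + j + e + p + q = k)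
    (hd : ∀ p q, Γ 0 0 1 p q = 0 ∧ Γ 0 1 1 p q = 0 ∧
      Γ 1 0 1 p q = -2 * (q + 1) * Γ 0 0 0 (p + 1) (q + 1) ∧
      Γ 1 1 1 p q = 2 * (q + 1) * Γ 0 1 0 (p + 1) (q + 1) ∧
      Γ 0 0 0 0 (q + 1) = 0 ∧ Γ 0 1 0 0 (q + 1) = 0) :
    ∃ z ∈ Zk F pF223 ordF223 (cF223 F) k, ∀ i j e p q, z (mono i j e p q) = Γ i j e p q := by
  obtain ⟨z, hz, h⟩ := exists_mem_admDeg_mono Γ hΓ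
  refine ⟨z, ⟨hz, ?_⟩, h⟩
  rw [SetLike.mem_coe, LinearMap.mem_ker, d_eq_zero_iff fun μ hμ => (hz μ hμ).1]
  simpa only [h] using hd

lemma hdim_F223_zero [CharZero F] : Hdim F pF223 ordF223 (cF223 F) 0 = 1 := by
  refine hdim_eq (LinearMap.pi ![Finsupp.lapply (mono 0 0 0 0 0)]) (fun z hz => ?_) fun w => ?_
  · rw [mem_Bk_iff hz]
    have hdeg {i j e p q : ℕ} := apply_mono_eq_zero (i := i) (j := j) (e := e) (p := p) (q := q) hz.1
    simp only [funext_iff, Fin.forall_fin_one]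
    constructor
    · intro h q
      rcases q with _ | q
      · simpa [hdeg] using h
      · simp [hdeg]
    · exact fun h => (h 0).1
  · obtain ⟨z, hz, h⟩ := exists_mem_Zk (F := F) (k := 0)
      (fun i j e p q => if i = 0 ∧ j = 0 ∧ e = 0 ∧ p = 0 ∧ q = 0 then w 0 else 0)
      (fun i j e p q => by split_ifs <;> simp; omega) (by simp)
    refine ⟨z, hz, ?_⟩
    ext i
    fin_cases i
    simp [h]

lemma hdim_F223_one [CharZero F] : Hdim F pF223 ordF223 (cF223 F) 1 = 3 := by
  refine hdim_eq (LinearMap.pi ![Finsupp.lapply (mono 0 0 0 1 0), Finsupp.lapply (mono 0 1 0 0 0),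
    Finsupp.lapply (mono 1 0 0 0 0)]) (fun z hz => ?_) fun w => ?_
  · rw [mem_Bk_iff hz]
    have hdeg {i j e p q : ℕ} := apply_mono_eq_zero (i := i) (j := j) (e := e) (p := p) (q := q) hz.1
    have hd := (d_eq_zero_iff fun μ hμ => (hz.1 μ hμ).1).1 hz.2
    simp only [funext_iff, Fin.forall_fin_succ]
    constructor
    · intro h q
      simp at h
      have h2 : z (mono 0 0 0 0 q) = 0 := by
        rcases q with _ | q
        · exact hdeg (by simp)
        · exact (hd 0 q).2.2.2.2.1
      have h3 : z (mono 0 1 0 1 q) = 0 := hdeg (by omega)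
      have h4 : z (mono 1 1 0 0 q) = 0 := hdeg (by omega)
      have h5 : z (mono 0 0 0 2 q) = 0 := hdeg (by omega)
      rcases q with _ | q <;> simp [h2, h3, h4, h5, h, hdeg]
    · intro h
      have := h 0
      simp_all
  · obtain ⟨z, hz, h⟩ := exists_mem_Zk (F := F) (k := 1)
      (fun i j e p q => if i = 0 ∧ j = 0 ∧ e = 0 ∧ p = 1 ∧ q = 0 then w 0
        else if i = 0 ∧ j = 1 ∧ e = 0 ∧ p = 0 ∧ q = 0 then w 1
        else if i = 1 ∧ j = 0 ∧ e = 0 ∧ p = 0 ∧ q = 0 then w 2 else 0)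
      (fun i j e p q => by split_ifs <;> simp <;> omega) (by simp)
    refine ⟨z, hz, ?_⟩
    ext i
    fin_cases i <;> simp [h]

lemma hdim_F223_add_two [CharZero F] (n : ℕ) : Hdim F pF223 ordF223 (cF223 F) (n + 2) = 4 := by
  refine hdim_eq (LinearMap.pi ![Finsupp.lapply (mono 0 0 0 1 (n + 1)),
    Finsupp.lapply (mono 0 1 0 1 n), Finsupp.lapply (mono 1 0 0 0 (n + 1)),
    Finsupp.lapply (mono 1 1 0 0 n) + (2 : F) • Finsupp.lapply (mono 0 0 0 2 n)])
    (fun z hz => ?_) fun w => ?_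
  · rw [mem_Bk_iff hz]
    have hdeg {i j e p q : ℕ} := apply_mono_eq_zero (i := i) (j := j) (e := e) (p := p) (q := q) hz.1
    have hd := (d_eq_zero_iff fun μ hμ => (hz.1 μ hμ).1).1 hz.2
    simp only [funext_iff, Fin.forall_fin_succ]
    constructor
    · rintro ⟨h1, h2, h3, h4, -⟩ q
      simp at h1 h2 h3 h4
      refine ⟨?_, ?_, ?_, ?_, ?_, ?_⟩
      · rcases q with _ | q
        · exact hdeg (by omega)
        · exact (hd 0 q).2.2.2.2.1
      · rcases eq_or_ne q (n + 1) with rfl | hq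
        · exact h1
        · exact hdeg (by omega)
      · rcases q with _ | q
        · exact hdeg (by omega)
        · exact (hd 0 q).2.2.2.2.2
      · rcases eq_or_ne q n with rfl | hq
        · exact h2
        · exact hdeg (by omega)
      · rcases eq_or_ne q (n + 1) with rfl | hq
        · exact h3
        · exact hdeg (by omega)
      · rcases eq_or_ne q n with rfl | hq
        · exact h4
        · rw [hdeg (by omega), hdeg (by omega), mul_zero, add_zero]
    · intro h
      have h0 := h n
      have h1 := h (n + 1)
      simp [h0, h1]
  · obtain ⟨z, hz, h⟩ := exists_mem_Zk (F := F) (k := n + 2)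
      (fun i j e p q => if i = 0 ∧ j = 0 ∧ e = 0 ∧ p = 1 ∧ q = n + 1 then w 0
        else if i = 1 ∧ j = 0 ∧ e = 1 ∧ p = 0 ∧ q = n then -2 * (n + 1) * w 0
        else if i = 0 ∧ j = 1 ∧ e = 0 ∧ p = 1 ∧ q = n then w 1
        else if i = 1 ∧ j = 1 ∧ e = 1 ∧ p = 0 ∧ q + 1 = n then 2 * n * w 1
        else if i = 1 ∧ j = 0 ∧ e = 0 ∧ p = 0 ∧ q = n + 1 then w 2
        else if i = 1 ∧ j = 1 ∧ e = 0 ∧ p = 0 ∧ q = n then w 3 else 0)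
      (fun i j e p q => by split_ifs <;> first | exact fun h => absurd rfl h | (intro; omega))
      (fun p q => by
        simp
        constructor
        · split_ifs <;> simp_all
        · split_ifs with h1
          · rw [← h1.2]; push_cast; ring
          · simp)
    refine ⟨z, hz, ?_⟩
    ext i
    fin_cases i <;> simp [h]

end Paper
end

noncomputable section
namespace Paper
open SuperCE

/-- For the filiform Lie superalgebra `F_{2,2}³` (nonzero brackets `[X₀,X₁] = [Y₁,Y₁] = X₂`, `[X₀,Y₁] = Y₂`) over an algebraically closed field of characteristic zero, the Betti numbers are `dim H^0 = 1`, `dim H^1 = 3` and `dim H^k = 4` for all `k ≥ 2`. -/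
theorem betti_F223
    (F : Type*) [Field F] [IsAlgClosed F] [CharZero F] :
    Hdim F pF223 ordF223 (cF223 F) 0 = 1 ∧
    Hdim F pF223 ordF223 (cF223 F) 1 = 3 ∧
    (∀ k : ℕ, 2 ≤ k → Hdim F pF223 ordF223 (cF223 F) k = 4) := by
  refine ⟨hdim_F223_zero, hdim_F223_one, fun k hk => ?_⟩
  obtain ⟨n, rfl⟩ := Nat.exists_eq_add_of_le' hk
  exact hdim_F223_add_two n

end Paper
end
end

section
/- For the filiform Lie superalgebra F_{2,2}^2 over an algebraically closed field of characteristic zero, the Betti numbers of cohomology with trivial coefficients are dim H^0 = 1, dim H^1 = 2, dim H^2 = 3, and dim H^k = 4 for all k ≥ 3. -/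
open scoped Classical
open Finset

noncomputable section
namespace Paper
open SuperCE

/-- parity of the basis (evens then odds) -/
def pF222 : Fin 3 ⊕ Fin 2 → ℕ := Sum.elim (fun _ => 0) (fun _ => 1)

/-- ordering of the basis -/
def ordF222 : Fin 3 ⊕ Fin 2 → ℕ :=
  Sum.elim (fun i => (i : ℕ)) (fun j => 3 + (j : ℕ))

/-- structure constants -/
def cF222 (F : Type*) [Field F] :
    (Fin 3 ⊕ Fin 2) → (Fin 3 ⊕ Fin 2) → (Fin 3 ⊕ Fin 2) → F :=
  fun a b t =>
    if a = Sum.inl (0 : Fin 3) ∧ b = Sum.inl (1 : Fin 3) ∧ t = Sum.inl (2 : Fin 3) then 1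
    else if a = Sum.inl (1 : Fin 3) ∧ b = Sum.inl (0 : Fin 3) ∧ t = Sum.inl (2 : Fin 3) then -1
    else    if a = Sum.inl (0 : Fin 3) ∧ b = Sum.inr (0 : Fin 2) ∧ t = Sum.inr (1 : Fin 2) then 1
    else if a = Sum.inr (0 : Fin 2) ∧ b = Sum.inl (0 : Fin 3) ∧ t = Sum.inr (1 : Fin 2) then -1
    else    if a = Sum.inr (0 : Fin 2) ∧ b = Sum.inr (0 : Fin 2) ∧ t = Sum.inl (1 : Fin 3) then 1
    else    if a = Sum.inr (0 : Fin 2) ∧ b = Sum.inr (1 : Fin 2) ∧ t = Sum.inl (2 : Fin 3) then (2 : F)⁻¹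
    else if a = Sum.inr (1 : Fin 2) ∧ b = Sum.inr (0 : Fin 2) ∧ t = Sum.inl (2 : Fin 3) then (2 : F)⁻¹
    else 0

end Paper
end

noncomputable section
namespace Paper
open SuperCE

/-- the exponent vector of the monomial `x₀ᵃ x₁ᵇ x₂ᶜ y₁ᵐ y₂ⁿ` -/
def expVec (a b c m n : ℕ) : Fin 3 ⊕ Fin 2 → ℕ := Sum.elim ![a, b, c] ![m, n]

lemma expVec_eta (μ : Fin 3 ⊕ Fin 2 → ℕ) :
    expVec (μ (.inl 0)) (μ (.inl 1)) (μ (.inl 2)) (μ (.inr 0)) (μ (.inr 1)) = μ := by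
  ext x
  rcases x with x | x <;> fin_cases x <;> rfl

lemma expVec_inj {a b c m n a' b' c' m' n' : ℕ} :
    expVec a b c m n = expVec a' b' c' m' n' ↔
      a = a' ∧ b = b' ∧ c = c' ∧ m = m' ∧ n = n' := by
  constructor
  · intro h
    exact ⟨congrFun h (.inl 0), congrFun h (.inl 1), congrFun h (.inl 2),
      congrFun h (.inr 0), congrFun h (.inr 1)⟩
  · rintro ⟨rfl, rfl, rfl, rfl, rfl⟩
    rfl

lemma isAdm_expVec {a b c m n : ℕ} :
    IsAdm pF222 (expVec a b c m n) ↔ a ≤ 1 ∧ b ≤ 1 ∧ c ≤ 1 := by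
  simp [IsAdm, pF222, expVec, Fin.forall_fin_succ]

lemma deg_expVec (a b c m n : ℕ) : deg (expVec a b c m n) = a + b + c + m + n := by
  simp [deg, expVec, Fin.sum_univ_succ]
  ring

lemma tgt_expVec_x₁ (a b c m n : ℕ) :
    tgt (expVec a b c m n) (.inl 1) (.inr 0) (.inr 0) = expVec a (b - 1) c (m + 2) n := by
  ext x
  rcases x with x | x <;> fin_cases x <;> simp [tgt, eps, expVec]

lemma tgt_expVec_x₂ (a b c m n : ℕ) :
    tgt (expVec a b c m n) (.inl 2) (.inl 0) (.inl 1) = expVec (a + 1) (b + 1) (c - 1) m n := by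
  ext x
  rcases x with x | x <;> fin_cases x <;> simp [tgt, eps, expVec]

lemma tgt_expVec_x₂' (a b c m n : ℕ) :
    tgt (expVec a b c m n) (.inl 2) (.inr 0) (.inr 1) = expVec a b (c - 1) (m + 1) (n + 1) := by
  ext x
  rcases x with x | x <;> fin_cases x <;> simp [tgt, eps, expVec]

lemma tgt_expVec_y₂ (a b c m n : ℕ) :
    tgt (expVec a b c m n) (.inr 1) (.inl 0) (.inr 0) = expVec (a + 1) b c (m + 1) (n - 1) := by
  ext x
  rcases x with x | x <;> fin_cases x <;> simp [tgt, eps, expVec]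

variable (F : Type*) [Field F]

lemma dcoef_F222 (b k l : Fin 3 ⊕ Fin 2) :
    dcoef F pF222 ordF222 (cF222 F) b k l =
      if b = .inl 1 ∧ k = .inr 0 ∧ l = .inr 0 then -(2 : F)⁻¹
      else if b = .inl 2 ∧ k = .inl 0 ∧ l = .inl 1 then 1
      else if b = .inl 2 ∧ k = .inr 0 ∧ l = .inr 1 then -(2 : F)⁻¹
      else if b = .inr 1 ∧ k = .inl 0 ∧ l = .inr 0 then 1
      else 0 := by
  rcases b with b | b <;> rcases k with k | k <;> rcases l with l | l <;> fin_cases b <;>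
    fin_cases k <;> fin_cases l <;> simp [dcoef, pF222, ordF222, cF222]

lemma neg_one_pow_mul_self (n : ℕ) : (-1 : F) ^ n * (-1) ^ n = 1 := by
  rw [← mul_pow, neg_one_mul, neg_neg, one_pow]

lemma neg_one_pow_sq (n : ℕ) : ((-1 : F) ^ n) ^ 2 = 1 := by
  rw [sq, neg_one_pow_mul_self]

/-- the contribution to `dMono μ` of replacing the generator `b` by the pair `(k, l)` -/
def dTerm (μ : Fin 3 ⊕ Fin 2 → ℕ) (b k l : Fin 3 ⊕ Fin 2) : Cochain F (Fin 3 ⊕ Fin 2) :=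
  if μ b ≠ 0 ∧ IsAdm pF222 (tgt μ b k l) then
    Finsupp.single (tgt μ b k l)
      (((-1 : F) ^ (∑ b', if ordF222 b' < ordF222 b then μ b' else 0)) *
       (μ b : F) * ((-1 : F) ^ ((μ b - 1) * pF222 b)) *
       ((-1 : F) ^ (pF222 b * ∑ b'', if ordF222 b < ordF222 b'' then μ b'' * pF222 b'' else 0)) *
       dcoef F pF222 ordF222 (cF222 F) b k l *
       sgnProd F pF222 ordF222 (fun x => μ x - eps b x) (fun x => eps k x + eps l x))
  else 0

lemma dMono_eq_sum_dTerm (μ : Fin 3 ⊕ Fin 2 → ℕ) :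
    dMono F pF222 ordF222 (cF222 F) μ = ∑ b, ∑ k, ∑ l, dTerm F μ b k l := by
  unfold dMono dTerm
  congr!

lemma dTerm_eq_zero {μ : Fin 3 ⊕ Fin 2 → ℕ} {b k l : Fin 3 ⊕ Fin 2}
    (h : dcoef F pF222 ordF222 (cF222 F) b k l = 0) : dTerm F μ b k l = 0 := by
  simp [dTerm, h]

lemma dMono_eq (μ : Fin 3 ⊕ Fin 2 → ℕ) :
    dMono F pF222 ordF222 (cF222 F) μ =
      dTerm F μ (.inl 1) (.inr 0) (.inr 0) + (dTerm F μ (.inl 2) (.inl 0) (.inl 1) +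
      dTerm F μ (.inl 2) (.inr 0) (.inr 1)) + dTerm F μ (.inr 1) (.inl 0) (.inr 0) := by
  rw [dMono_eq_sum_dTerm]
  simp only [Fintype.sum_sum_type, Fin.sum_univ_succ, Fin.sum_univ_zero]
  simp [dTerm_eq_zero, dcoef_F222]

lemma dTerm_x₁ (a b c m n : ℕ) : dTerm F (expVec a b c m n) (.inl 1) (.inr 0) (.inr 0) =
    if b ≠ 0 ∧ a ≤ 1 ∧ b - 1 ≤ 1 ∧ c ≤ 1 then
      Finsupp.single (expVec a (b - 1) c (m + 2) n) ((-1) ^ a * b * -(2 : F)⁻¹) else 0 := by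
  have hd : dcoef F pF222 ordF222 (cF222 F) (.inl 1) (.inr 0) (.inr 0) = -(2 : F)⁻¹ := by
    simp [dcoef_F222]
  simp only [dTerm, tgt_expVec_x₁, isAdm_expVec, hd]
  refine if_congr Iff.rfl (congrArg _ ?_) rfl
  simp [sgnProd, Fin.sum_univ_succ, expVec, pF222, ordF222, eps, pow_mul, neg_one_pow_sq]

lemma dTerm_x₂ (a b c m n : ℕ) : dTerm F (expVec a b c m n) (.inl 2) (.inl 0) (.inl 1) =
    if c ≠ 0 ∧ a + 1 ≤ 1 ∧ b + 1 ≤ 1 ∧ c - 1 ≤ 1 then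
      Finsupp.single (expVec (a + 1) (b + 1) (c - 1) m n) (c : F) else 0 := by
  have hd : dcoef F pF222 ordF222 (cF222 F) (.inl 2) (.inl 0) (.inl 1) = 1 := by
    simp [dcoef_F222]
  simp only [dTerm, tgt_expVec_x₂, isAdm_expVec, hd,
    show expVec a b c m n (.inl 2) = c from rfl]
  by_cases h : c ≠ 0 ∧ a + 1 ≤ 1 ∧ b + 1 ≤ 1 ∧ c - 1 ≤ 1
  · rw [if_pos h, if_pos h]
    obtain ⟨-, ha, hb, -⟩ := h
    obtain rfl : a = 0 := by omega
    obtain rfl : b = 0 := by omega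
    congr 1
    simp [sgnProd, Fin.sum_univ_succ, expVec, pF222, ordF222, eps, pow_add, neg_one_pow_mul_self]
  · rw [if_neg h, if_neg h]

lemma dTerm_x₂' (a b c m n : ℕ) : dTerm F (expVec a b c m n) (.inl 2) (.inr 0) (.inr 1) =
    if c ≠ 0 ∧ a ≤ 1 ∧ b ≤ 1 ∧ c - 1 ≤ 1 then
      Finsupp.single (expVec a b (c - 1) (m + 1) (n + 1)) ((-1) ^ (a + b) * c * -(2 : F)⁻¹)
      else 0 := by
  have hd : dcoef F pF222 ordF222 (cF222 F) (.inl 2) (.inr 0) (.inr 1) = -(2 : F)⁻¹ := by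
    simp [dcoef_F222]
  simp only [dTerm, tgt_expVec_x₂', isAdm_expVec, hd]
  refine if_congr Iff.rfl (congrArg _ ?_) rfl
  simp [sgnProd, Fin.sum_univ_succ, expVec, pF222, ordF222, eps, pow_add, pow_mul,
    neg_one_pow_sq]

lemma dTerm_y₂ (a b c m n : ℕ) : dTerm F (expVec a b c m n) (.inr 1) (.inl 0) (.inr 0) =
    if n ≠ 0 ∧ a + 1 ≤ 1 ∧ b ≤ 1 ∧ c ≤ 1 then
      Finsupp.single (expVec (a + 1) b c (m + 1) (n - 1)) (n : F) else 0 := by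
  have hd : dcoef F pF222 ordF222 (cF222 F) (.inr 1) (.inl 0) (.inr 0) = 1 := by
    simp [dcoef_F222]
  simp only [dTerm, tgt_expVec_y₂, isAdm_expVec, hd,
    show expVec a b c m n (.inr 1) = n from rfl]
  by_cases h : n ≠ 0 ∧ a + 1 ≤ 1 ∧ b ≤ 1 ∧ c ≤ 1
  · rw [if_pos h, if_pos h]
    obtain ⟨-, ha, -, -⟩ := h
    obtain rfl : a = 0 := by omega
    congr 1
    simp [sgnProd, Fin.sum_univ_succ, expVec, pF222, ordF222, eps, pow_add]
    linear_combination (n : F) * ((-1) ^ (n - 1) * (-1) ^ (n - 1)) *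
        ((-1) ^ m * (-1) ^ m) * ((-1) ^ c * (-1) ^ c) * neg_one_pow_mul_self F b +
      n * ((-1) ^ (n - 1) * (-1) ^ (n - 1)) * ((-1) ^ m * (-1) ^ m) * neg_one_pow_mul_self F c +
      n * ((-1) ^ (n - 1) * (-1) ^ (n - 1)) * neg_one_pow_mul_self F m +
      n * neg_one_pow_mul_self F (n - 1)
  · rw [if_neg h, if_neg h]

open Polynomial in
@[elab_as_elim]
lemma degreeLT_induction {N : ℕ} {P : F[X] → Prop} (zero : P 0)
    (add : ∀ p q, P p → P q → P (p + q)) (monomial : ∀ n < N, ∀ r, P (monomial n r))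
    {p : F[X]} (hp : p ∈ degreeLT F N) : P p := by
  have h : p = ∑ n ∈ Finset.range N, Polynomial.monomial n (p.coeff n) := by
    ext m
    simp only [finsetSum_coeff, coeff_monomial, Finset.sum_ite_eq', Finset.mem_range]
    split_ifs with hm
    · rfl
    · exact coeff_eq_zero_of_degree_lt
        ((mem_degreeLT.1 hp).trans_le (by exact_mod_cast not_lt.1 hm))
  rw [h]
  exact Finset.sum_induction _ P add zero fun n hn => monomial n (Finset.mem_range.1 hn) _

/-- index of a square-free monomial in `x₀, x₁, x₂` -/
abbrev ExtIdx := Fin 2 × Fin 2 × Fin 2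

/-- degree of a square-free monomial in `x₀, x₁, x₂` -/
def ExtIdx.wt (s : ExtIdx) : ℕ := s.1 + s.2.1 + s.2.2

/-- exponent vector of the degree `k` monomial with exterior part `s` and `y₂`-exponent `n` -/
def homVec (s : ExtIdx) (k n : ℕ) : Fin 3 ⊕ Fin 2 → ℕ :=
  expVec s.1 s.2.1 s.2.2 (k - s.wt - n) n

lemma homVec_inj {s t : ExtIdx} {k n m : ℕ} : homVec s k n = homVec t k m ↔ s = t ∧ n = m := by
  rw [homVec, homVec, expVec_inj]
  constructor
  · rintro ⟨h₀, h₁, h₂, -, h⟩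
    exact ⟨Prod.ext (Fin.ext h₀) (Prod.ext (Fin.ext h₁) (Fin.ext h₂)), h⟩
  · rintro ⟨rfl, rfl⟩
    simp

open Polynomial

/-- homogenisation: `X ^ n` is sent to the degree `k` monomial with exterior part `s` and
`y₂`-exponent `n` -/
def hom (s : ExtIdx) (k : ℕ) : F[X] →ₗ[F] Cochain F (Fin 3 ⊕ Fin 2) :=
  lsum fun n => Finsupp.lsingle (homVec s k n)

lemma hom_monomial (s : ExtIdx) (k n : ℕ) (r : F) :
    hom F s k (monomial n r) = Finsupp.single (homVec s k n) r := by
  simp [hom, lsum_apply, sum_monomial_index]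

lemma hom_apply (s t : ExtIdx) (k n : ℕ) (p : F[X]) :
    hom F s k p (homVec t k n) = if s = t then p.coeff n else 0 := by
  induction p using Polynomial.induction_on' with
  | add p q hp hq => simp only [map_add, Finsupp.add_apply, hp, hq, coeff_add]; split_ifs <;> simp
  | monomial m r =>
    simp only [hom_monomial, Finsupp.single_apply, homVec_inj, coeff_monomial, ite_and]

lemma hom_mem {s : ExtIdx} {k : ℕ} {p : F[X]} (hp : p ∈ degreeLT F (k + 1 - s.wt)) :
    hom F s k p ∈ AdmDeg F pF222 k := by
  refine degreeLT_induction F ?_ ?_ ?_ hp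
  · simp
  · intro p q hp hq
    rw [map_add]
    exact add_mem hp hq
  · intro n hn r μ hμ
    rw [hom_monomial] at hμ
    obtain rfl : μ = homVec s k n := by
      by_contra h
      exact hμ (Finsupp.single_eq_of_ne h)
    rw [homVec, isAdm_expVec, deg_expVec]
    simp only [ExtIdx.wt] at *
    omega

lemma d_single (μ : Fin 3 ⊕ Fin 2 → ℕ) (r : F) :
    d F pF222 ordF222 (cF222 F) (Finsupp.single μ r) =
      r • dMono F pF222 ordF222 (cF222 F) μ := by
  simp [d]

lemma d_hom_000 {k : ℕ} {p : F[X]} (hp : p ∈ degreeLT F (k + 1)) :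
    d F pF222 ordF222 (cF222 F) (hom F (0, 0, 0) k p) =
      hom F (1, 0, 0) (k + 1) (derivative p) := by
  refine degreeLT_induction F ?_ ?_ ?_ hp
  · simp
  · intro p q hp hq
    simp only [map_add, hp, hq]
  · intro n hn r
    obtain ⟨j, rfl⟩ : ∃ j, k = j + n := ⟨k - 0 - n, by omega⟩
    simp only [derivative_monomial, hom_monomial, d_single]
    rcases n with _ | n
    · simp [homVec, ExtIdx.wt, dMono_eq, dTerm_x₁, dTerm_x₂, dTerm_x₂', dTerm_y₂]
    · have h (i : ℕ) : j + (n + i) - n = j + i := by omega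
      simp [homVec, ExtIdx.wt, dMono_eq, dTerm_x₁, dTerm_x₂, dTerm_x₂', dTerm_y₂]
      ext μ
      simp [Finsupp.single_apply, h]
      split_ifs <;> ring

lemma d_hom_100 {k : ℕ} {p : F[X]} (hp : p ∈ degreeLT F (k + 1 - 1)) :
    d F pF222 ordF222 (cF222 F) (hom F (1, 0, 0) k p) = 0 := by
  refine degreeLT_induction F ?_ ?_ ?_ hp
  · simp
  · intro p q hp hq
    simp only [map_add, hp, hq, add_zero]
  · intro n hn r
    obtain ⟨j, rfl⟩ : ∃ j, k = j + n + 1 := ⟨k - 1 - n, by omega⟩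
    simp only [hom_monomial, d_single]
    simp [homVec, ExtIdx.wt, dMono_eq, dTerm_x₁, dTerm_x₂, dTerm_x₂', dTerm_y₂]

lemma d_hom_010 {k : ℕ} {p : F[X]} (hp : p ∈ degreeLT F (k + 1 - 1)) :
    d F pF222 ordF222 (cF222 F) (hom F (0, 1, 0) k p) =
      -(2 : F)⁻¹ • hom F (0, 0, 0) (k + 1) p + hom F (1, 1, 0) (k + 1) (derivative p) := by
  refine degreeLT_induction F ?_ ?_ ?_ hp
  · simp
  · intro p q hp hq
    simp only [map_add, hp, hq, smul_add]
    abel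
  · intro n hn r
    obtain ⟨j, rfl⟩ : ∃ j, k = j + n + 1 := ⟨k - 1 - n, by omega⟩
    simp only [derivative_monomial, hom_monomial, d_single]
    rcases n with _ | n
    · simp [homVec, ExtIdx.wt, dMono_eq, dTerm_x₁, dTerm_x₂, dTerm_x₂', dTerm_y₂]
      ext μ
      simp [Finsupp.single_apply]
      split_ifs <;> ring
    · have h (i : ℕ) : j + (n + i) - n = j + i := by omega
      simp [homVec, ExtIdx.wt, dMono_eq, dTerm_x₁, dTerm_x₂, dTerm_x₂', dTerm_y₂]
      ext μ
      simp [Finsupp.single_apply, h, add_assoc]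
      split_ifs <;> ring

lemma d_hom_001 {k : ℕ} {p : F[X]} (hp : p ∈ degreeLT F (k + 1 - 1)) :
    d F pF222 ordF222 (cF222 F) (hom F (0, 0, 1) k p) =
      hom F (1, 1, 0) (k + 1) p - (2 : F)⁻¹ • hom F (0, 0, 0) (k + 1) (X * p) +
        hom F (1, 0, 1) (k + 1) (derivative p) := by
  refine degreeLT_induction F ?_ ?_ ?_ hp
  · simp
  · intro p q hp hq
    simp only [map_add, hp, hq, mul_add, smul_add]
    abel
  · intro n hn r
    obtain ⟨j, rfl⟩ : ∃ j, k = j + n + 1 := ⟨k - 1 - n, by omega⟩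
    simp only [derivative_monomial, X_mul_monomial, hom_monomial, d_single]
    rcases n with _ | n
    · simp [homVec, ExtIdx.wt, dMono_eq, dTerm_x₁, dTerm_x₂, dTerm_x₂', dTerm_y₂]
      ext μ
      simp [Finsupp.single_apply]
      split_ifs <;> ring
    · have h (i : ℕ) : j + (n + i) - n = j + i := by omega
      simp [homVec, ExtIdx.wt, dMono_eq, dTerm_x₁, dTerm_x₂, dTerm_x₂', dTerm_y₂]
      ext μ
      simp [Finsupp.single_apply, h, add_assoc]
      split_ifs <;> ring

lemma d_hom_110 {k : ℕ} {p : F[X]} (hp : p ∈ degreeLT F (k + 1 - 2)) :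
    d F pF222 ordF222 (cF222 F) (hom F (1, 1, 0) k p) =
      (2 : F)⁻¹ • hom F (1, 0, 0) (k + 1) p := by
  refine degreeLT_induction F ?_ ?_ ?_ hp
  · simp
  · intro p q hp hq
    simp only [map_add, hp, hq, smul_add]
  · intro n hn r
    obtain ⟨j, rfl⟩ : ∃ j, k = j + n + 2 := ⟨k - 2 - n, by omega⟩
    simp only [hom_monomial, d_single]
    rcases n with _ | n
    · simp [homVec, ExtIdx.wt, dMono_eq, dTerm_x₁, dTerm_x₂, dTerm_x₂', dTerm_y₂]
      ext μ
      simp [Finsupp.single_apply]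
      split_ifs <;> ring
    · have h (i : ℕ) : j + (n + i) - n = j + i := by omega
      simp [homVec, ExtIdx.wt, dMono_eq, dTerm_x₁, dTerm_x₂, dTerm_x₂', dTerm_y₂]
      ext μ
      simp [Finsupp.single_apply, h, add_assoc]
      split_ifs <;> ring

lemma d_hom_101 {k : ℕ} {p : F[X]} (hp : p ∈ degreeLT F (k + 1 - 2)) :
    d F pF222 ordF222 (cF222 F) (hom F (1, 0, 1) k p) =
      (2 : F)⁻¹ • hom F (1, 0, 0) (k + 1) (X * p) := by
  refine degreeLT_induction F ?_ ?_ ?_ hp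
  · simp
  · intro p q hp hq
    simp only [map_add, hp, hq, mul_add, smul_add]
  · intro n hn r
    obtain ⟨j, rfl⟩ : ∃ j, k = j + n + 2 := ⟨k - 2 - n, by omega⟩
    simp only [X_mul_monomial, hom_monomial, d_single]
    rcases n with _ | n
    · simp [homVec, ExtIdx.wt, dMono_eq, dTerm_x₁, dTerm_x₂, dTerm_x₂', dTerm_y₂]
      ext μ
      simp [Finsupp.single_apply]
      split_ifs <;> ring
    · have h (i : ℕ) : j + (n + i) - n = j + i := by omega
      simp [homVec, ExtIdx.wt, dMono_eq, dTerm_x₁, dTerm_x₂, dTerm_x₂', dTerm_y₂]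
      ext μ
      simp [Finsupp.single_apply, h, add_assoc]
      split_ifs <;> ring

lemma d_hom_011 {k : ℕ} {p : F[X]} (hp : p ∈ degreeLT F (k + 1 - 2)) :
    d F pF222 ordF222 (cF222 F) (hom F (0, 1, 1) k p) =
      -(2 : F)⁻¹ • hom F (0, 0, 1) (k + 1) p + (2 : F)⁻¹ • hom F (0, 1, 0) (k + 1) (X * p) +
        hom F (1, 1, 1) (k + 1) (derivative p) := by
  refine degreeLT_induction F ?_ ?_ ?_ hp
  · simp
  · intro p q hp hq
    simp only [map_add, hp, hq, mul_add, smul_add]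
    abel
  · intro n hn r
    obtain ⟨j, rfl⟩ : ∃ j, k = j + n + 2 := ⟨k - 2 - n, by omega⟩
    simp only [derivative_monomial, X_mul_monomial, hom_monomial, d_single]
    rcases n with _ | n
    · simp [homVec, ExtIdx.wt, dMono_eq, dTerm_x₁, dTerm_x₂, dTerm_x₂', dTerm_y₂]
      ext μ
      simp [Finsupp.single_apply]
      split_ifs <;> ring
    · have h (i : ℕ) : j + (n + i) - n = j + i := by omega
      simp [homVec, ExtIdx.wt, dMono_eq, dTerm_x₁, dTerm_x₂, dTerm_x₂', dTerm_y₂]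
      ext μ
      simp [Finsupp.single_apply, h, add_assoc]
      split_ifs <;> ring

lemma d_hom_111 {k : ℕ} {p : F[X]} (hp : p ∈ degreeLT F (k + 1 - 3)) :
    d F pF222 ordF222 (cF222 F) (hom F (1, 1, 1) k p) =
      (2 : F)⁻¹ • hom F (1, 0, 1) (k + 1) p - (2 : F)⁻¹ • hom F (1, 1, 0) (k + 1) (X * p) := by
  refine degreeLT_induction F ?_ ?_ ?_ hp
  · simp
  · intro p q hp hq
    simp only [map_add, hp, hq, mul_add, smul_add]
    abel
  · intro n hn r
    obtain ⟨j, rfl⟩ : ∃ j, k = j + n + 3 := ⟨k - 3 - n, by omega⟩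
    simp only [X_mul_monomial, hom_monomial, d_single]
    rcases n with _ | n
    · simp [homVec, ExtIdx.wt, dMono_eq, dTerm_x₁, dTerm_x₂, dTerm_x₂', dTerm_y₂]
      ext μ
      simp [Finsupp.single_apply]
      split_ifs <;> ring
    · have h (i : ℕ) : j + (n + i) - n = j + i := by omega
      simp [homVec, ExtIdx.wt, dMono_eq, dTerm_x₁, dTerm_x₂, dTerm_x₂', dTerm_y₂]
      ext μ
      simp [Finsupp.single_apply, h, add_assoc]
      split_ifs <;> ring

/-- the cochain of degree `k` with dehomogenised coefficients `v` -/
def homSum (k : ℕ) : (ExtIdx → F[X]) →ₗ[F] Cochain F (Fin 3 ⊕ Fin 2) :=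
  ∑ s, hom F s k ∘ₗ LinearMap.proj s

lemma homSum_apply (k : ℕ) (v : ExtIdx → F[X]) : homSum F k v = ∑ s, hom F s k (v s) := by
  simp [homSum]

lemma homSum_apply_homVec (k : ℕ) (v : ExtIdx → F[X]) (s : ExtIdx) (n : ℕ) :
    homSum F k v (homVec s k n) = (v s).coeff n := by
  simp [homSum_apply, Finsupp.finsetSum_apply, hom_apply]

lemma homSum_injective (k : ℕ) : Function.Injective (homSum F k) := by
  intro v w h
  ext s n
  rw [← homSum_apply_homVec, h, homSum_apply_homVec]

lemma homSum_mem {k : ℕ} {v : ExtIdx → F[X]} (hv : ∀ s, v s ∈ degreeLT F (k + 1 - s.wt)) :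
    homSum F k v ∈ AdmDeg F pF222 k := by
  rw [homSum_apply]
  exact sum_mem fun s _ => hom_mem F (hv s)

lemma exists_homVec_eq {k : ℕ} {μ : Fin 3 ⊕ Fin 2 → ℕ} (h : IsAdm pF222 μ) (hk : deg μ = k) :
    ∃ s n, n < k + 1 - ExtIdx.wt s ∧ homVec s k n = μ := by
  rw [← expVec_eta μ] at h hk ⊢
  rw [isAdm_expVec] at h
  rw [deg_expVec] at hk
  refine ⟨(⟨μ (.inl 0), by omega⟩, ⟨μ (.inl 1), by omega⟩, ⟨μ (.inl 2), by omega⟩),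
    μ (.inr 1), ?_, ?_⟩
  · simp only [ExtIdx.wt]
    omega
  · rw [homVec, expVec_inj]
    refine ⟨rfl, rfl, rfl, ?_, rfl⟩
    simp only [ExtIdx.wt]
    omega

lemma exists_homSum_eq {k : ℕ} {w : Cochain F (Fin 3 ⊕ Fin 2)} (hw : w ∈ AdmDeg F pF222 k) :
    ∃ v : ExtIdx → F[X], (∀ s, v s ∈ degreeLT F (k + 1 - s.wt)) ∧ homSum F k v = w := by
  let v : ExtIdx → F[X] := fun s =>
    ∑ n ∈ Finset.range (k + 1 - s.wt), monomial n (w (homVec s k n))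
  have hv : ∀ s, v s ∈ degreeLT F (k + 1 - s.wt) := fun s =>
    sum_mem fun n hn => monomial_coe_mem_degreeLT ⟨n, Finset.mem_range.1 hn⟩ _
  refine ⟨v, hv, ?_⟩
  ext μ
  by_cases hμ : IsAdm pF222 μ ∧ deg μ = k
  · obtain ⟨s, n, hn, rfl⟩ := exists_homVec_eq hμ.1 hμ.2
    rw [homSum_apply_homVec]
    simp [v, finsetSum_coeff, coeff_monomial, hn]
  · rw [not_imp_comm.1 (homSum_mem F hv μ) hμ, not_imp_comm.1 (hw μ) hμ]

/-- a family of polynomials indexed by `ExtIdx`, given by its eight entries -/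
def mkFamily (f c b h a g e m : F[X]) : ExtIdx → F[X] :=
  fun s => ![![![f, c], ![b, h]], ![![a, g], ![e, m]]] s.1 s.2.1 s.2.2

/-- the Chevalley–Eilenberg differential on dehomogenised coefficients -/
def polyD (v : ExtIdx → F[X]) : ExtIdx → F[X] :=
  mkFamily F
    (-(2 : F)⁻¹ • (v (0, 1, 0) + X * v (0, 0, 1)))
    (-(2 : F)⁻¹ • v (0, 1, 1))
    ((2 : F)⁻¹ • (X * v (0, 1, 1)))
    0
    (derivative (v (0, 0, 0)) + (2 : F)⁻¹ • (v (1, 1, 0) + X * v (1, 0, 1)))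
    (derivative (v (0, 0, 1)) + (2 : F)⁻¹ • v (1, 1, 1))
    (derivative (v (0, 1, 0)) + v (0, 0, 1) - (2 : F)⁻¹ • (X * v (1, 1, 1)))
    (derivative (v (0, 1, 1)))

lemma d_homSum {k : ℕ} {v : ExtIdx → F[X]} (hv : ∀ s, v s ∈ degreeLT F (k + 1 - s.wt)) :
    d F pF222 ordF222 (cF222 F) (homSum F k v) = homSum F (k + 1) (polyD F v) := by
  simp only [homSum_apply, Fintype.sum_prod_type, Fin.sum_univ_two, map_add,
    d_hom_000 F (hv (0, 0, 0)), d_hom_001 F (hv (0, 0, 1)), d_hom_010 F (hv (0, 1, 0)),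
    d_hom_011 F (hv (0, 1, 1)), d_hom_100 F (hv (1, 0, 0)), d_hom_101 F (hv (1, 0, 1)),
    d_hom_110 F (hv (1, 1, 0)), d_hom_111 F (hv (1, 1, 1))]
  simp [polyD, mkFamily]
  module

lemma polyD_polyD (v : ExtIdx → F[X]) : polyD F (polyD F v) = 0 := by
  ext1 ⟨i, j, l⟩
  fin_cases i <;> fin_cases j <;> fin_cases l <;>
    simp [polyD, mkFamily, derivative_mul, smul_eq_C_mul] <;> ring

lemma derivative_mem {n N : ℕ} {p : F[X]} (hp : p ∈ degreeLT F n) (h : n ≤ N + 1) :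
    derivative p ∈ degreeLT F N := by
  rw [mem_degreeLT, degree_lt_iff_coeff_zero] at *
  intro m hm
  rw [coeff_derivative, hp _ (by omega), zero_mul]

lemma X_mul_mem {n N : ℕ} {p : F[X]} (hp : p ∈ degreeLT F n) (h : n = 0 ∨ n + 1 ≤ N) :
    X * p ∈ degreeLT F N := by
  rw [mem_degreeLT, degree_lt_iff_coeff_zero] at *
  intro m hm
  rcases m with _ | m
  · simp
  · rw [coeff_X_mul, hp _ (by omega)]

lemma forall_extIdx {P : ExtIdx → Prop} :
    (∀ s, P s) ↔ P (0, 0, 0) ∧ P (0, 0, 1) ∧ P (0, 1, 0) ∧ P (0, 1, 1) ∧ P (1, 0, 0) ∧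
      P (1, 0, 1) ∧ P (1, 1, 0) ∧ P (1, 1, 1) := by
  simp [Prod.forall, Fin.forall_fin_two, and_assoc]

lemma polyD_mem {k : ℕ} {v : ExtIdx → F[X]} (hv : ∀ s, v s ∈ degreeLT F (k + 1 - s.wt)) :
    ∀ s, polyD F v s ∈ degreeLT F (k + 1 + 1 - s.wt) := by
  rw [forall_extIdx] at *
  obtain ⟨hf, hc, hb, hh, ha, hg, he, hm⟩ := hv
  have mono {n N : ℕ} {p : F[X]} (hp : p ∈ degreeLT F n) (h : n ≤ N) : p ∈ degreeLT F N :=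
    degreeLT_mono h hp
  refine ⟨Submodule.smul_mem _ _ (add_mem (mono hb ?_) (X_mul_mem F hc ?_)),
    Submodule.smul_mem _ _ (mono hh ?_), Submodule.smul_mem _ _ (X_mul_mem F hh ?_),
    zero_mem _, add_mem (derivative_mem F hf ?_)
      (Submodule.smul_mem _ _ (add_mem (mono he ?_) (X_mul_mem F hg ?_))),
    add_mem (derivative_mem F hc ?_) (Submodule.smul_mem _ _ (mono hm ?_)),
    sub_mem (add_mem (derivative_mem F hb ?_) (mono hc ?_))
      (Submodule.smul_mem _ _ (X_mul_mem F hm ?_)), derivative_mem F hh ?_⟩ <;>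
  simp only [ExtIdx.wt, Fin.val_zero, Fin.val_one] <;> omega

lemma finrank_degreeLT (n : ℕ) : Module.finrank F (degreeLT F n) = n := by
  rw [(degreeLTEquiv F n).finrank_eq, Module.finrank_fin_fun]

instance (n : ℕ) : Module.Finite F (degreeLT F n) :=
  Module.Finite.equiv (degreeLTEquiv F n).symm

/-- formal antiderivative without constant term -/
def antideriv : F[X] →ₗ[F] F[X] :=
  lsum fun n => ((n + 1 : F)⁻¹) • monomial (n + 1)

lemma antideriv_monomial (n : ℕ) (r : F) :
    antideriv F (monomial n r) = monomial (n + 1) ((n + 1 : F)⁻¹ * r) := by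
  simp [antideriv, lsum_apply, sum_monomial_index, smul_monomial]

lemma derivative_antideriv [CharZero F] (p : F[X]) : derivative (antideriv F p) = p := by
  induction p using Polynomial.induction_on' with
  | add p q hp hq => simp only [map_add, hp, hq]
  | monomial n r =>
    have : (n + 1 : F) ≠ 0 := by exact_mod_cast n.succ_ne_zero
    rw [antideriv_monomial, derivative_monomial]
    push_cast
    congr 1
    field_simp

lemma antideriv_mem {n N : ℕ} {p : F[X]} (hp : p ∈ degreeLT F n) (h : n + 1 ≤ N) :
    antideriv F p ∈ degreeLT F N := by
  refine degreeLT_induction F ?_ ?_ ?_ hp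
  · simp
  · intro p q hp hq
    rw [map_add]
    exact add_mem hp hq
  · intro m hm r
    rw [antideriv_monomial]
    exact monomial_coe_mem_degreeLT ⟨m + 1, by omega⟩ _

lemma range_homSum_comp_pi_subtype (k : ℕ) :
    LinearMap.range (homSum F k ∘ₗ LinearMap.pi fun s : ExtIdx =>
      (degreeLT F (k + 1 - s.wt)).subtype ∘ₗ LinearMap.proj s) = AdmDeg F pF222 k := by
  apply le_antisymm
  · rintro _ ⟨v, rfl⟩
    exact homSum_mem F fun s => (v s).2
  · intro w hw
    obtain ⟨v, hv, rfl⟩ := exists_homSum_eq F hw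
    exact ⟨fun s => ⟨v s, hv s⟩, rfl⟩

instance (k : ℕ) : Module.Finite F (AdmDeg F pF222 k) := by
  rw [← range_homSum_comp_pi_subtype]
  infer_instance

lemma finrank_admDeg (k : ℕ) :
    Module.finrank F (AdmDeg F pF222 k) = (k + 1) + 3 * k + 3 * (k - 1) + (k - 2) := by
  rw [← range_homSum_comp_pi_subtype, LinearMap.finrank_range_of_inj, Module.finrank_pi_fintype]
  · rw [Finset.sum_congr rfl fun s _ => finrank_degreeLT F (k + 1 - s.wt)]
    simp [Fintype.sum_prod_type, ExtIdx.wt]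
    omega
  · refine (homSum_injective F k).comp fun v w h => ?_
    ext1 s
    exact Subtype.ext (congrFun h s)

/-- the dehomogenised cocycle with free entries `a`, `c`, `e`, `g` and constant term `t` -/
def cocycleFamily (k : ℕ) :
    degreeLT F k × degreeLT F (k - 1) × degreeLT F (k - 1) × degreeLT F (k - 1) × F →ₗ[F]
      ExtIdx → F[X] where
  toFun := fun (a, c, e, g, t) => mkFamily F
    (C t + antideriv F (-(2 : F)⁻¹ • ((e : F[X]) + X * (g : F[X]))))
    c (-(X * (c : F[X]))) 0 a g e (-(2 : F) • derivative (c : F[X]))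
  map_add' x y := by
    ext1 ⟨i, j, l⟩
    fin_cases i <;> fin_cases j <;> fin_cases l <;> simp [mkFamily, mul_add] <;>
      module
  map_smul' r x := by
    ext1 ⟨i, j, l⟩
    fin_cases i <;> fin_cases j <;> fin_cases l <;> 
      simp [mkFamily] <;> simp only [smul_eq_C_mul] <;> ring

lemma cocycleFamily_injective (k : ℕ) : Function.Injective (cocycleFamily F k) := by
  rintro ⟨a, c, e, g, t⟩ ⟨a', c', e', g', t'⟩ h
  have ha : a = a' := Subtype.ext (congrFun h (1, 0, 0))
  have hc : c = c' := Subtype.ext (congrFun h (0, 0, 1))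
  have hg : g = g' := Subtype.ext (congrFun h (1, 0, 1))
  have he : e = e' := Subtype.ext (congrFun h (1, 1, 0))
  subst ha hc hg he
  have ht : C t = C t' := add_right_cancel (congrFun h (0, 0, 0))
  rw [C_injective ht]

lemma cocycleFamily_mem {k : ℕ}
    (x : degreeLT F k × degreeLT F (k - 1) × degreeLT F (k - 1) × degreeLT F (k - 1) × F) :
    ∀ s, cocycleFamily F k x s ∈ degreeLT F (k + 1 - s.wt) := by
  obtain ⟨⟨a, ha⟩, ⟨c, hc⟩, ⟨e, he⟩, ⟨g, hg⟩, t⟩ := x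
  rw [forall_extIdx]
  have hC : C t ∈ degreeLT F (k + 1) :=
    mem_degreeLT.2 (degree_C_le.trans_lt (by exact_mod_cast k.succ_pos))
  exact ⟨add_mem hC (antideriv_mem F (Submodule.smul_mem _ _
      (add_mem (degreeLT_mono (Nat.sub_le k 1) he) (X_mul_mem F hg (by omega)))) le_rfl),
    degreeLT_mono (Nat.sub_le k 1) hc, neg_mem (X_mul_mem F hc (by simp [ExtIdx.wt]; omega)),
    zero_mem _, ha, hg, he,
    Submodule.smul_mem _ _ (derivative_mem F hc (by simp [ExtIdx.wt]; omega))⟩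

lemma polyD_cocycleFamily [CharZero F] {k : ℕ}
    (x : degreeLT F k × degreeLT F (k - 1) × degreeLT F (k - 1) × degreeLT F (k - 1) × F) :
    polyD F (cocycleFamily F k x) = 0 := by
  ext1 ⟨i, j, l⟩
  fin_cases i <;> fin_cases j <;> fin_cases l <;>
    simp [polyD, cocycleFamily, mkFamily, derivative_mul, derivative_antideriv, smul_smul]
  module

lemma exists_cocycleFamily_eq [CharZero F] {k : ℕ} {v : ExtIdx → F[X]}
    (hv : ∀ s, v s ∈ degreeLT F (k + 1 - s.wt)) (h : polyD F v = 0) :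
    ∃ x, cocycleFamily F k x = v := by
  have h2 : (2 : F) ≠ 0 := two_ne_zero
  have hb : v (0, 1, 0) = -(X * v (0, 0, 1)) := by
    have : -(2 : F)⁻¹ • (v (0, 1, 0) + X * v (0, 0, 1)) = 0 := congrFun h (0, 0, 0)
    exact eq_neg_of_add_eq_zero_left
      ((smul_eq_zero.1 this).resolve_left (neg_ne_zero.2 (inv_ne_zero h2)))
  have hh : v (0, 1, 1) = 0 := by
    have := congrFun h (0, 0, 1)
    simpa [polyD, mkFamily] using this
  have hm : v (1, 1, 1) = -(2 : F) • derivative (v (0, 0, 1)) := by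
    have : derivative (v (0, 0, 1)) + (2 : F)⁻¹ • v (1, 1, 1) = 0 := congrFun h (1, 0, 1)
    rw [eq_neg_of_add_eq_zero_left this, smul_neg, neg_smul, neg_neg, smul_smul,
      mul_inv_cancel₀ h2, one_smul]
  have hf : derivative (v (0, 0, 0)) =
      -(2 : F)⁻¹ • (v (1, 1, 0) + X * v (1, 0, 1)) := by
    have := congrFun h (1, 0, 0)
    rw [neg_smul]
    exact eq_neg_of_add_eq_zero_left this
  have hc : v (0, 0, 1) ∈ degreeLT F (k - 1) := by
    have : X * v (0, 0, 1) ∈ degreeLT F k := neg_mem_iff.1 (hb ▸ hv (0, 1, 0))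
    rw [mem_degreeLT, degree_lt_iff_coeff_zero] at *
    intro m hm
    rw [← coeff_X_mul, this _ (by omega)]
  obtain ⟨t, ht⟩ : ∃ t, v (0, 0, 0) =
      C t + antideriv F (-(2 : F)⁻¹ • (v (1, 1, 0) + X * v (1, 0, 1))) := by
    refine ⟨_, sub_eq_iff_eq_add.1 (eq_C_of_derivative_eq_zero ?_)⟩
    rw [derivative_sub, derivative_antideriv, hf, sub_self]
  refine ⟨⟨⟨v (1, 0, 0), hv (1, 0, 0)⟩, ⟨v (0, 0, 1), hc⟩, ⟨v (1, 1, 0), hv (1, 1, 0)⟩,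
    ⟨v (1, 0, 1), hv (1, 0, 1)⟩, t⟩, ?_⟩
  ext1 s
  revert s
  rw [forall_extIdx]
  exact ⟨ht.symm, rfl, hb.symm, hh.symm, rfl, rfl, rfl, hm.symm⟩

lemma range_homSum_comp_cocycleFamily [CharZero F] (k : ℕ) :
    LinearMap.range (homSum F k ∘ₗ cocycleFamily F k) = Zk F pF222 ordF222 (cF222 F) k := by
  apply le_antisymm
  · rintro _ ⟨x, rfl⟩
    refine ⟨homSum_mem F (cocycleFamily_mem F x), ?_⟩
    rw [SetLike.mem_coe, LinearMap.mem_ker, LinearMap.comp_apply,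
      d_homSum F (cocycleFamily_mem F x), polyD_cocycleFamily, map_zero]
  · rintro w ⟨hw, hd⟩
    obtain ⟨v, hv, rfl⟩ := exists_homSum_eq F hw
    rw [SetLike.mem_coe, LinearMap.mem_ker, d_homSum F hv] at hd
    obtain ⟨x, rfl⟩ := exists_cocycleFamily_eq F hv
      (homSum_injective F (k + 1) (hd.trans (map_zero _).symm))
    exact ⟨x, rfl⟩

lemma finrank_Zk [CharZero F] (k : ℕ) :
    Module.finrank F (Zk F pF222 ordF222 (cF222 F) k) = k + 3 * (k - 1) + 1 := by
  rw [← range_homSum_comp_cocycleFamily, LinearMap.finrank_range_of_inj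
    (by simpa using (homSum_injective F k).comp (cocycleFamily_injective F k))]
  simp only [Module.finrank_prod, finrank_degreeLT, Module.finrank_self]
  omega

lemma finrank_map_d_add_finrank_Zk (k : ℕ) :
    Module.finrank F ((AdmDeg F pF222 k).map (d F pF222 ordF222 (cF222 F))) +
      Module.finrank F (Zk F pF222 ordF222 (cF222 F) k) =
      Module.finrank F (AdmDeg F pF222 k) := by
  have h := LinearMap.finrank_range_add_finrank_ker (K := F) (V := AdmDeg F pF222 k)
    (V₂ := Cochain F (Fin 3 ⊕ Fin 2)) ((d F pF222 ordF222 (cF222 F)).domRestrict (AdmDeg F pF222 k))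
  rwa [LinearMap.range_domRestrict, LinearMap.ker_domRestrict,
    ← Submodule.finrank_map_subtype_eq, Submodule.map_comap_subtype] at h

lemma Bk_succ_le_Zk (k : ℕ) :
    Bk F pF222 ordF222 (cF222 F) (k + 1) ≤ Zk F pF222 ordF222 (cF222 F) (k + 1) := by
  rintro _ ⟨w, hw, rfl⟩
  obtain ⟨v, hv, rfl⟩ := exists_homSum_eq F hw
  rw [Nat.add_sub_cancel] at hv ⊢
  rw [d_homSum F hv]
  refine ⟨homSum_mem F (polyD_mem F hv), ?_⟩
  rw [SetLike.mem_coe, LinearMap.mem_ker, d_homSum F (polyD_mem F hv), polyD_polyD, map_zero]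

lemma Hdim_succ [CharZero F] (k : ℕ) :
    Hdim F pF222 ordF222 (cF222 F) (k + 1) = (k + 1) + 3 * k + 1 -
      ((k + 1) + 3 * k + 3 * (k - 1) + (k - 2) - (k + 3 * (k - 1) + 1)) := by
  rw [Hdim, inf_eq_left.2 (Bk_succ_le_Zk F k), finrank_Zk, Bk, Nat.add_sub_cancel,
    ← finrank_admDeg F k, ← finrank_Zk F k, ← finrank_map_d_add_finrank_Zk F k,
    Nat.add_sub_cancel]

lemma Hdim_zero [CharZero F] : Hdim F pF222 ordF222 (cF222 F) 0 = 1 := by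
  have h := finrank_map_d_add_finrank_Zk F 0
  rw [finrank_Zk, finrank_admDeg] at h
  have hB : Module.finrank F (Bk F pF222 ordF222 (cF222 F) 0 : Submodule F _) = 0 := by
    rw [Bk, Nat.zero_sub]
    omega
  have : Module.Finite F (Bk F pF222 ordF222 (cF222 F) 0) := by
    rw [Bk]
    infer_instance
  rw [Hdim, Submodule.finrank_eq_zero.1 hB, bot_inf_eq, finrank_bot, finrank_Zk]

end Paper
end

noncomputable section
namespace Paper
open SuperCE

/-- For the filiform Lie superalgebra `F_{2,2}²` (nonzero brackets `[X₀,X₁] = X₂`, `[X₀,Y₁] = Y₂`, `[Y₁,Y₁] = X₁`, `[Y₁,Y₂] = (1/2)X₂`) over an algebraically closed field of characteristic zero, the Betti numbers are `dim H^0 = 1`, `dim H^1 = 2`, `dim H^2 = 3` and `dim H^k = 4` for all `k ≥ 3`. -/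
theorem betti_F222
    (F : Type*) [Field F] [IsAlgClosed F] [CharZero F] :
    Hdim F pF222 ordF222 (cF222 F) 0 = 1 ∧
    Hdim F pF222 ordF222 (cF222 F) 1 = 2 ∧
    Hdim F pF222 ordF222 (cF222 F) 2 = 3 ∧
    (∀ k : ℕ, 3 ≤ k → Hdim F pF222 ordF222 (cF222 F) k = 4) := by
  refine ⟨Hdim_zero F, Hdim_succ F 0, Hdim_succ F 1, fun k hk => ?_⟩
  obtain ⟨n, rfl⟩ : ∃ n, k = n + 3 := ⟨k - 3, by omega⟩
  rw [Hdim_succ]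
  omega

end Paper
end
end

section
/- For the ideal I = span{X_1, X_2, Y_1, Y_2} of the filiform Lie superalgebra F_{2,2}^2 (where [Y_1,Y_1] = X_1, [Y_1,Y_2] = (1/2)X_2, other brackets among these generators zero), for every k ≥ 2 the k-th cohomology H^k(I) of I with trivial coefficients is two-dimensional, with basis represented by the cocycles Y_2*^k and X_1* ∧ Y_2*^{k-1} − X_2* ∧ Y_1* ∧ Y_2*^{k-2}. -/
open scoped Classical
open Finset

noncomputable section
namespace Paper
open SuperCE

/-- parity of the basis (evens then odds) -/
def pIdeal : Fin 2 ⊕ Fin 2 → ℕ := Sum.elim (fun _ => 0) (fun _ => 1)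

/-- ordering of the basis -/
def ordIdeal : Fin 2 ⊕ Fin 2 → ℕ :=
  Sum.elim (fun i => (i : ℕ)) (fun j => 2 + (j : ℕ))

/-- structure constants -/
def cIdeal (F : Type*) [Field F] :
    (Fin 2 ⊕ Fin 2) → (Fin 2 ⊕ Fin 2) → (Fin 2 ⊕ Fin 2) → F :=
  fun a b t =>
    if a = Sum.inr (0 : Fin 2) ∧ b = Sum.inr (0 : Fin 2) ∧ t = Sum.inl (0 : Fin 2) then 1
    else    if a = Sum.inr (0 : Fin 2) ∧ b = Sum.inr (1 : Fin 2) ∧ t = Sum.inl (1 : Fin 2) then (2 : F)⁻¹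
    else if a = Sum.inr (1 : Fin 2) ∧ b = Sum.inr (0 : Fin 2) ∧ t = Sum.inl (1 : Fin 2) then (2 : F)⁻¹
    else 0

end Paper
end

noncomputable section
namespace Paper
open SuperCE

/-- representatives of the basis of `H^k(I)` for `k ≥ 2`:
`Y_2*^k` and `X_1* ∧ Y_2*^{k-1} − X_2* ∧ Y_1* ∧ Y_2*^{k-2}`
(here `Sum.inl 0, Sum.inl 1` are `X₁, X₂` and `Sum.inr 0, Sum.inr 1` are `Y₁, Y₂`). -/
def Ibasis (F : Type*) [Field F] (k : ℕ) : Fin 2 → Cochain F (Fin 2 ⊕ Fin 2) :=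
  ![Finsupp.single (fun x => if x = Sum.inr (1 : Fin 2) then k else 0) 1,
    Finsupp.single (fun x => if x = Sum.inl (0 : Fin 2) then 1
        else if x = Sum.inr (1 : Fin 2) then k - 1 else 0) 1 -
      Finsupp.single (fun x => if x = Sum.inl (1 : Fin 2) then 1
        else if x = Sum.inr (0 : Fin 2) then 1
        else if x = Sum.inr (1 : Fin 2) then k - 2 else 0) 1]

/-- The exponent vector of `X₁*^a X₂*^b Y₁*^m Y₂*^n`. -/
def mon (a b m n : ℕ) : Fin 2 ⊕ Fin 2 → ℕ := Sum.elim ![a, b] ![m, n]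

lemma eq_mon (μ : Fin 2 ⊕ Fin 2 → ℕ) :
    μ = mon (μ (.inl 0)) (μ (.inl 1)) (μ (.inr 0)) (μ (.inr 1)) := by
  ext x
  rcases x with x | x <;> fin_cases x <;> rfl

lemma mon_inj {a b m n a' b' m' n' : ℕ} :
    mon a b m n = mon a' b' m' n' ↔ a = a' ∧ b = b' ∧ m = m' ∧ n = n' := by
  refine ⟨fun h => ⟨?_, ?_, ?_, ?_⟩, by rintro ⟨rfl, rfl, rfl, rfl⟩; rfl⟩
  exacts [congrFun h (.inl 0), congrFun h (.inl 1), congrFun h (.inr 0), congrFun h (.inr 1)]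

lemma isAdm_mon {a b m n : ℕ} : IsAdm pIdeal (mon a b m n) ↔ a ≤ 1 ∧ b ≤ 1 := by
  simp [IsAdm, pIdeal, mon, Fin.forall_fin_two]

lemma deg_mon (a b m n : ℕ) : deg (mon a b m n) = a + b + m + n := by
  simp [deg, mon, Fin.sum_univ_two, add_assoc]

lemma tgt_mon_inl_zero (a b m n : ℕ) :
    tgt (mon a b m n) (.inl 0) (.inr 0) (.inr 0) = mon (a - 1) b (m + 2) n := by
  ext x
  rcases x with x | x <;> fin_cases x <;> simp [tgt, eps, mon]

lemma tgt_mon_inl_one (a b m n : ℕ) :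
    tgt (mon a b m n) (.inl 1) (.inr 0) (.inr 1) = mon a (b - 1) (m + 1) (n + 1) := by
  ext x
  rcases x with x | x <;> fin_cases x <;> simp [tgt, eps, mon]

lemma sgnProd_inr (F : Type*) [Field F] (μ : Fin 2 ⊕ Fin 2 → ℕ) (l : Fin 2) :
    sgnProd F pIdeal ordIdeal μ (fun x => eps (.inr 0) x + eps (.inr l) x) = 1 := by
  refine Even.neg_one_pow ?_
  fin_cases l <;>
    simp [Fintype.sum_sum_type, Fin.sum_univ_two, pIdeal, ordIdeal, eps]

lemma dMono_mon (F : Type*) [Field F] {a b : ℕ} (ha : a ≤ 1) (hb : b ≤ 1) (m n : ℕ) :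
    dMono F pIdeal ordIdeal (cIdeal F) (mon a b m n) =
      (if a = 1 then Finsupp.single (mon 0 b (m + 2) n) (-(2 : F)⁻¹) else 0) +
      (if b = 1 then Finsupp.single (mon a 0 (m + 1) (n + 1)) ((-1) ^ a * -(2 : F)⁻¹) else 0) := by
  have hcoef : ∀ b k l, dcoef F pIdeal ordIdeal (cIdeal F) b k l =
      (if b = .inl 0 ∧ k = .inr 0 ∧ l = .inr 0 then -(2 : F)⁻¹ else 0) +
      (if b = .inl 1 ∧ k = .inr 0 ∧ l = .inr 1 then -(2 : F)⁻¹ else 0) := by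
    intro b k l
    rcases b with b | b <;> rcases k with k | k <;> rcases l with l | l <;> fin_cases b <;>
      fin_cases k <;> fin_cases l <;> simp [dcoef, pIdeal, ordIdeal, cIdeal]
  simp only [dMono, hcoef, Fintype.sum_sum_type, Fin.sum_univ_two]
  interval_cases a <;> interval_cases b <;>
    simp [tgt_mon_inl_zero, tgt_mon_inl_one, isAdm_mon, sgnProd_inr, -Finsupp.single_mul]
  all_goals simp [pIdeal, ordIdeal, mon, -Finsupp.single_mul]

lemma d_single_s17 {F : Type*} [Field F] {a b : ℕ} (ha : a ≤ 1) (hb : b ≤ 1) (m n : ℕ) (r : F) :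
    d F pIdeal ordIdeal (cIdeal F) (.single (mon a b m n) r) =
      (if a = 1 then .single (mon 0 b (m + 2) n) (-(2 : F)⁻¹ * r) else 0) +
      (if b = 1 then .single (mon a 0 (m + 1) (n + 1)) ((-1) ^ a * -(2 : F)⁻¹ * r) else 0) := by
  rw [d, Finsupp.lsum_single, LinearMap.toSpanSingleton_apply, dMono_mon F ha hb]
  rw [smul_add]
  split_ifs <;> simp only [Finsupp.smul_single, smul_zero, smul_eq_mul, mul_comm r]

/-- Values on monomials of a contracting homotopy of the complex onto the span of the
representatives in degrees at least `2`. -/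
def homotopyMono (F : Type*) [Field F] (μ : Fin 2 ⊕ Fin 2 → ℕ) : Cochain F (Fin 2 ⊕ Fin 2) :=
  match μ (.inl 0), μ (.inl 1), μ (.inr 0), μ (.inr 1) with
  | 0, 0, m + 2, n => .single (mon 1 0 m n) (-2)
  | 0, 0, 1, n + 1 => .single (mon 0 1 0 n) (-2)
  | 0, 1, m + 2, n => .single (mon 1 1 m n) (-2)
  | _, _, _, _ => 0

/-- The linear extension of `homotopyMono`. -/
def homotopy (F : Type*) [Field F] :
    Cochain F (Fin 2 ⊕ Fin 2) →ₗ[F] Cochain F (Fin 2 ⊕ Fin 2) :=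
  Finsupp.linearCombination F (homotopyMono F)

/-- The coordinates of a cochain of degree `k` with respect to the representatives. -/
def coord (F : Type*) [Field F] (k : ℕ) : Cochain F (Fin 2 ⊕ Fin 2) →ₗ[F] (Fin 2 → F) :=
  LinearMap.pi ![Finsupp.lapply (mon 0 0 0 k), -Finsupp.lapply (mon 0 1 1 (k - 2))]

lemma coord_apply {F : Type*} [Field F] (k : ℕ) (z : Cochain F (Fin 2 ⊕ Fin 2)) :
    coord F k z = ![z (mon 0 0 0 k), -z (mon 0 1 1 (k - 2))] := by
  ext i
  fin_cases i <;> simp [coord]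

lemma Ibasis_zero (F : Type*) [Field F] (k : ℕ) :
    Ibasis F k 0 = .single (mon 0 0 0 k) 1 := by
  simp only [Ibasis, Matrix.cons_val_zero]
  congr 1
  ext x
  rcases x with x | x <;> fin_cases x <;> simp [mon]

lemma Ibasis_one (F : Type*) [Field F] (k : ℕ) :
    Ibasis F k 1 = .single (mon 1 0 0 (k - 1)) 1 - .single (mon 0 1 1 (k - 2)) 1 := by
  simp only [Ibasis, Matrix.cons_val_one, Matrix.cons_val_fin_one]
  congr 2 <;> ext x <;> rcases x with x | x <;> fin_cases x <;> simp [mon]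

lemma single_mem_admDeg {F : Type*} [Field F] {a b m n k : ℕ} (ha : a ≤ 1) (hb : b ≤ 1)
    (hk : a + b + m + n = k) (r : F) :
    Finsupp.single (mon a b m n) r ∈ AdmDeg F pIdeal k := by
  intro μ hμ
  obtain rfl : mon a b m n = μ := by
    by_contra h
    exact hμ (Finsupp.single_eq_of_ne' h)
  exact ⟨isAdm_mon.2 ⟨ha, hb⟩, (deg_mon ..).trans hk⟩

/-- Induction on cochains of degree `k` along their expansion in monomials. -/
lemma admDeg_induction {F : Type*} [Field F] {k : ℕ}
    {P : Cochain F (Fin 2 ⊕ Fin 2) → Prop} (zero : P 0) (add : ∀ f g, P f → P g → P (f + g))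
    (single : ∀ a b m n, a ≤ 1 → b ≤ 1 → a + b + m + n = k → ∀ r, P (.single (mon a b m n) r))
    (z : Cochain F (Fin 2 ⊕ Fin 2)) (hz : z ∈ AdmDeg F pIdeal k) : P z := by
  rw [← z.sum_single]
  refine Finset.sum_induction _ P add zero fun μ hμ => ?_
  obtain ⟨h₁, h₂⟩ := hz μ (Finsupp.mem_support_iff.1 hμ)
  generalize z μ = r
  rw [eq_mon μ] at h₁ h₂ ⊢
  rw [isAdm_mon] at h₁
  exact single _ _ _ _ h₁.1 h₁.2 (by rw [← h₂, deg_mon]) r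

lemma homotopy_single {F : Type*} [Field F] (a b m n : ℕ) (r : F) :
    homotopy F (.single (mon a b m n) r) =
      match a, b, m, n with
      | 0, 0, m + 2, n => .single (mon 1 0 m n) (-2 * r)
      | 0, 0, 1, n + 1 => .single (mon 0 1 0 n) (-2 * r)
      | 0, 1, m + 2, n => .single (mon 1 1 m n) (-2 * r)
      | _, _, _, _ => 0 := by
  rw [homotopy, Finsupp.linearCombination_single, homotopyMono]
  simp only [mon, Sum.elim_inl, Sum.elim_inr, Matrix.cons_val_zero, Matrix.cons_val_one,
    Matrix.cons_val_fin_one]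
  split <;> simp [mul_comm]

lemma homotopy_mem {F : Type*} [Field F] {k : ℕ} {z : Cochain F (Fin 2 ⊕ Fin 2)}
    (hz : z ∈ AdmDeg F pIdeal k) : homotopy F z ∈ AdmDeg F pIdeal (k - 1) := by
  refine admDeg_induction (P := fun z => homotopy F z ∈ AdmDeg F pIdeal (k - 1)) ?_ ?_ ?_ z hz
  · simp
  · intro f g hf hg
    simpa using add_mem hf hg
  · intro a b m n ha hb hk r
    rw [homotopy_single]
    split
    · exact single_mem_admDeg le_rfl zero_le_one (by omega) _
    · exact single_mem_admDeg zero_le_one le_rfl (by omega) _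
    · exact single_mem_admDeg le_rfl le_rfl (by omega) _
    · exact zero_mem _

lemma homotopy_formula {F : Type*} [Field F] [CharZero F] {k : ℕ} (hk : 2 ≤ k)
    {z : Cochain F (Fin 2 ⊕ Fin 2)} (hz : z ∈ AdmDeg F pIdeal k) :
    d F pIdeal ordIdeal (cIdeal F) (homotopy F z) +
      homotopy F (d F pIdeal ordIdeal (cIdeal F) z) + ∑ i, coord F k z i • Ibasis F k i = z := by
  refine admDeg_induction (P := fun z =>
    d F pIdeal ordIdeal (cIdeal F) (homotopy F z) +
      homotopy F (d F pIdeal ordIdeal (cIdeal F) z) + ∑ i, coord F k z i • Ibasis F k i = z)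
    ?_ ?_ ?_ z hz
  · simp
  · intro f g hf hg
    refine Eq.trans ?_ (congrArg₂ (· + ·) hf hg)
    simp only [map_add, Pi.add_apply, add_smul, Finset.sum_add_distrib]
    abel
  · intro a b m n ha hb hn r
    subst hn
    interval_cases a <;> interval_cases b <;> rcases m with _ | _ | m <;> rcases n with _ | n <;>
      simp [Fin.sum_univ_two, Ibasis_zero, Ibasis_one, coord_apply, d_single_s17, homotopy_single,
        mon_inj, -Finsupp.single_mul]
    · omega
    · simp [smul_sub]
    · simp [smul_sub, add_comm 2 n]

lemma coord_d {F : Type*} [Field F] {k l : ℕ} {w : Cochain F (Fin 2 ⊕ Fin 2)}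
    (hw : w ∈ AdmDeg F pIdeal l) : coord F k (d F pIdeal ordIdeal (cIdeal F) w) = 0 := by
  refine admDeg_induction (P := fun w => coord F k (d F pIdeal ordIdeal (cIdeal F) w) = 0)
    ?_ ?_ ?_ w hw
  · simp
  · intro f g hf hg
    simp [hf, hg]
  · intro a b m n ha hb hn r
    rw [d_single_s17 ha hb, coord_apply]
    interval_cases a <;> interval_cases b <;> simp [mon_inj]

lemma coord_Ibasis {F : Type*} [Field F] (k : ℕ) (i : Fin 2) :
    coord F k (Ibasis F k i) = Pi.single i 1 := by
  rw [coord_apply]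
  ext j
  fin_cases i <;> fin_cases j <;>
    simp [Ibasis_zero, Ibasis_one, mon_inj]

lemma coord_sum {F : Type*} [Field F] (k : ℕ) (a : Fin 2 → F) :
    coord F k (∑ i, a i • Ibasis F k i) = a := by
  simp only [map_sum, map_smul, coord_Ibasis]
  exact (pi_eq_sum_univ' a).symm

lemma Ibasis_mem_Zk {F : Type*} [Field F] {k : ℕ} (hk : 2 ≤ k) (i : Fin 2) :
    Ibasis F k i ∈ Zk F pIdeal ordIdeal (cIdeal F) k := by
  refine ⟨?_, LinearMap.mem_ker.2 ?_⟩
  · fin_cases i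
    · simpa [Ibasis_zero] using single_mem_admDeg zero_le_one zero_le_one (by omega) _
    · simp only [Fin.mk_one, Ibasis_one]
      exact sub_mem (single_mem_admDeg le_rfl zero_le_one (by omega) _)
        (single_mem_admDeg zero_le_one le_rfl (by omega) _)
  · fin_cases i
    · simp [Ibasis_zero, d_single_s17]
    · obtain ⟨k, rfl⟩ := Nat.exists_eq_add_of_le' hk
      simp [Ibasis_one, d_single_s17]

lemma sub_mem_Bk {F : Type*} [Field F] [CharZero F] {k : ℕ} (hk : 2 ≤ k)
    {z : Cochain F (Fin 2 ⊕ Fin 2)} (hz : z ∈ Zk F pIdeal ordIdeal (cIdeal F) k) :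
    z - ∑ i, coord F k z i • Ibasis F k i ∈ Bk F pIdeal ordIdeal (cIdeal F) k := by
  refine ⟨homotopy F z, homotopy_mem hz.1, ?_⟩
  have h := homotopy_formula hk hz.1
  rw [LinearMap.mem_ker.1 hz.2, map_zero, add_zero] at h
  exact eq_sub_of_add_eq h

lemma coord_eq_zero_of_mem_Bk {F : Type*} [Field F] {k : ℕ} {z : Cochain F (Fin 2 ⊕ Fin 2)}
    (hz : z ∈ Bk F pIdeal ordIdeal (cIdeal F) k) : coord F k z = 0 := by
  obtain ⟨w, hw, rfl⟩ := hz
  exact coord_d hw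

instance finiteDimensional_admDeg {F : Type*} [Field F] (k : ℕ) :
    FiniteDimensional F (AdmDeg F pIdeal k) := by
  have hfin : {μ : Fin 2 ⊕ Fin 2 → ℕ | deg μ = k}.Finite :=
    (Set.finite_Iic fun _ => k).subset fun μ hμ x =>
      (Finset.single_le_sum (fun _ _ => Nat.zero_le _) (Finset.mem_univ x)).trans_eq hμ
  have := hfin.to_subtype
  have : FiniteDimensional F (Finsupp.supported F F {μ : Fin 2 ⊕ Fin 2 → ℕ | deg μ = k}) :=
    Module.Finite.equiv (Finsupp.supportedEquivFinsupp _).symm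
  refine Submodule.finiteDimensional_of_le (S₂ := Finsupp.supported F F {μ | deg μ = k}) ?_
  exact fun f hf μ hμ => (hf μ (Finsupp.mem_support_iff.1 hμ)).2

lemma Hdim_eq_two {F : Type*} [Field F] [CharZero F] {k : ℕ} (hk : 2 ≤ k) :
    Hdim F pIdeal ordIdeal (cIdeal F) k = 2 := by
  set Z := Zk F pIdeal ordIdeal (cIdeal F) k with hZ
  set C := Bk F pIdeal ordIdeal (cIdeal F) k with hC
  have : FiniteDimensional F Z := Submodule.finiteDimensional_of_le inf_le_left
  let φ := (coord F k).comp Z.subtype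
  have hφ : LinearMap.range φ = ⊤ := by
    refine LinearMap.range_eq_top.2 fun a => ⟨⟨∑ i, a i • Ibasis F k i, ?_⟩, coord_sum k a⟩
    exact sum_mem fun i _ => Z.smul_mem _ (Ibasis_mem_Zk hk i)
  have hker : (LinearMap.ker φ).map Z.subtype = C ⊓ Z := by
    ext z
    constructor
    · rintro ⟨z, hz, rfl⟩
      refine ⟨?_, z.2⟩
      have h := sub_mem_Bk hk z.2
      rwa [show coord F k z = 0 from hz, Fintype.sum_eq_zero _ (by simp), sub_zero] at h
    · exact fun hz => ⟨⟨z, hz.2⟩, coord_eq_zero_of_mem_Bk hz.1, rfl⟩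
  have h := LinearMap.finrank_range_add_finrank_ker (K := F) (V := Z) (V₂ := Fin 2 → F) φ
  rw [hφ, finrank_top, Module.finrank_fin_fun, ← Submodule.finrank_map_subtype_eq, hker] at h
  rw [Hdim, ← hZ, ← hC, ← h, Nat.add_sub_cancel]

/-- For the nilpotent Lie superalgebra `I` with even basis `X₁, X₂`,
odd basis `Y₁, Y₂` and nonzero brackets `[Y₁,Y₁] = X₁`, `[Y₁,Y₂] = (1/2)X₂`
(the ideal `span{X₁,X₂,Y₁,Y₂}` of `F_{2,2}²`), for every `k ≥ 2` the cohomology `H^k(I)`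
with trivial coefficients is two-dimensional, with basis represented by the cocycles
`Y₂*^k` and `X₁* ∧ Y₂*^{k-1} − X₂* ∧ Y₁* ∧ Y₂*^{k-2}`. -/
theorem cohomology_ideal_F222
    (F : Type*) [Field F] [IsAlgClosed F] [CharZero F] :
    ∀ k : ℕ, 2 ≤ k →
      Hdim F pIdeal ordIdeal (cIdeal F) k = 2 ∧
      (∀ i : Fin 2, Ibasis F k i ∈ Zk F pIdeal ordIdeal (cIdeal F) k) ∧
      (∀ a : Fin 2 → F,
        (∑ i, a i • Ibasis F k i) ∈ Bk F pIdeal ordIdeal (cIdeal F) k → a = 0) ∧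
      (∀ z ∈ Zk F pIdeal ordIdeal (cIdeal F) k,
        ∃ a : Fin 2 → F,
          z - (∑ i, a i • Ibasis F k i) ∈ Bk F pIdeal ordIdeal (cIdeal F) k) := by
  exact fun k hk => ⟨Hdim_eq_two hk, Ibasis_mem_Zk hk, fun a ha =>
    (coord_sum k a).symm.trans (coord_eq_zero_of_mem_Bk ha), fun z hz => ⟨_, sub_mem_Bk hk hz⟩⟩

end Paper
end
end
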